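/- arXiv:1605.01766 — 3 statements merged into one kernel-verified Lean document; each statement's English description precedes it below -/
import Mathlib

section
/- Let G = G₁ * ⋯ * Gₙ be a free product of nontrivial finite groups, acting on its Bass–Serre tree T (edge stabilizers trivial, vertex stabilizers conjugates of the Gᵢ). Let A ∈ G be a cyclically reduced element of infinite order and g ∈ G such that A and gAg⁻¹ do not commute. If D is a cyclically reduced word conjugate to A^{N₁}(gAg⁻¹)^{N₂} with N₁, N₂ ≥ 2, then the syllable length satisfies |D| > (N₁ + N₂ − 4)|A|. -/
open Monoid

/-- The syllable length of an element of a free product: the length of its unique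
reduced word. -/
noncomputable def syllableLength {ι : Type*} (G : ι → Type*) [∀ i, Group (G i)]
    (A : CoprodI G) : ℕ := by
  classical exact (CoprodI.Word.equiv A).toList.length

/-- An element of a free product is cyclically reduced if its reduced word has length
at most one, or its first and last syllables lie in different free factors. -/
def IsCyclicallyReduced {ι : Type*} (G : ι → Type*) [∀ i, Group (G i)]
    (A : CoprodI G) : Prop := by
  classical exact
    (CoprodI.Word.equiv A).toList.length ≤ 1 ∨
      ∃ hd ∈ (CoprodI.Word.equiv A).toList.head?,
        ∃ lst ∈ (CoprodI.Word.equiv A).toList.getLast?,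
          hd.1 ≠ lst.1

/-- Length functions coming from a free action on (vertices of) a tree. -/
structure TreeLen (H : Type*) [Group H] (l : H → ℤ) : Prop where
  one : l 1 = 0
  eq_one : ∀ x, l x ≤ 0 → x = 1
  inv : ∀ x, l x⁻¹ = l x
  four : ∀ (k : ℤ) (x y z : H), k ≤ l x + l y - l (x⁻¹ * y) → k ≤ l y + l z - l (y⁻¹ * z) →
    k ≤ l x + l z - l (x⁻¹ * z)
  pre : ∀ x, x ≠ 1 → ∃ s, l s = 1 ∧ l (s⁻¹ * x) = l x - 1

namespace TreeLen

variable {H : Type*} [Group H] {l : H → ℤ}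

theorem nonneg (h : TreeLen H l) (x : H) : 0 ≤ l x := by
  by_contra hx
  have := h.eq_one x (by omega)
  rw [this, h.one] at hx
  omega

theorem tri (h : TreeLen H l) (x y : H) : l (x * y) ≤ l x + l y := by
  have := h.four 0 x⁻¹ 1 y (by simp [h.one, h.inv]) (by simp [h.one])
  rw [inv_inv, h.inv] at this
  omega

theorem symm (h : TreeLen H l) (x y : H) : l (x⁻¹ * y) = l (y⁻¹ * x) := by
  rw [← h.inv]; simp

theorem pow_le (h : TreeLen H l) (x : H) (n : ℕ) : l (x ^ n) ≤ n * l x := by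
  induction n with
  | zero => simp [h.one]
  | succ n ih =>
    rw [pow_succ]
    have := h.tri (x ^ n) x
    push_cast
    linarith

theorem growth (h : TreeLen H l) (f : H) (hf : l f < l (f ^ 2)) (n : ℕ) :
    l (f ^ n) + (l (f ^ 2) - l f) ≤ l (f ^ (n + 1)) := by
  induction n with
  | zero =>
    have := h.pow_le f 2
    simp only [pow_zero, h.one, zero_add, pow_one]
    push_cast at this
    linarith
  | succ n ih =>
    by_contra hc
    push Not at hc
    have e1 : (f⁻¹)⁻¹ * f ^ (n + 1) = f ^ (n + 1 + 1) := by rw [inv_inv, ← pow_succ']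
    have e2 : (f ^ (n + 1))⁻¹ * f = (f ^ n)⁻¹ := by rw [pow_succ']; group
    have e3 : (f⁻¹)⁻¹ * f = f ^ 2 := by rw [inv_inv, pow_two]
    have := h.four (2 * l f - l (f ^ 2) + 1) f⁻¹ (f ^ (n + 1)) f
      (by rw [e1, h.inv]; linarith) (by rw [e2, h.inv]; linarith)
    rw [e3, h.inv] at this
    linarith

theorem growth_mul (h : TreeLen H l) (f : H) (hf : l f < l (f ^ 2)) (n : ℕ) :
    n * (l (f ^ 2) - l f) ≤ l (f ^ n) := by
  induction n with
  | zero => simp [h.one]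
  | succ n ih =>
    have := h.growth f hf n
    push_cast
    linarith

theorem conj_le (h : TreeLen H l) (f u : H) (hf : l f < l (f ^ 2)) :
    l (f ^ 2) - l f ≤ l (u⁻¹ * f * u) := by
  by_contra hc
  push Not at hc
  obtain ⟨m, hm⟩ := Int.eq_ofNat_of_zero_le (h.nonneg u)
  have h1 := h.growth_mul f hf (2 * m + 1)
  have h2 := h.pow_le (u⁻¹ * f * u) (2 * m + 1)
  have e : f ^ (2 * m + 1) = u * (u⁻¹ * f * u) ^ (2 * m + 1) * u⁻¹ := by
    rw [← conj_pow]; group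
  have h3 := h.tri (u * (u⁻¹ * f * u) ^ (2 * m + 1)) u⁻¹
  have h4 := h.tri u ((u⁻¹ * f * u) ^ (2 * m + 1))
  rw [← e, h.inv] at h3
  have h5 : ((2 * m + 1 : ℕ) : ℤ) * (l (u⁻¹ * f * u) + 1) ≤
      ((2 * m + 1 : ℕ) : ℤ) * (l (f ^ 2) - l f) :=
    mul_le_mul_of_nonneg_left (by omega) (by positivity)
  push_cast at *
  linarith

/-- `l (UV)^2 - l (UV)` is large if there is little cancellation. -/
theorem two_pieces (h : TreeLen H l) (U V : H) (a b : ℤ)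
    (hUV : l U + l V - a ≤ l (U * V)) (hVU : l U + l V - b ≤ l (V * U))
    (h1 : a + b < 2 * l U) (h2 : a + b < 2 * l V) (ha : 0 ≤ a) (hb : 0 ≤ b) :
    l U + l V - a - b ≤ l ((U * V) ^ 2) - l (U * V) := by
  have t1 := h.tri U V
  -- (x1|x3)_{x2} = (V⁻¹|U), (x1|x0) = (V⁻¹ | V⁻¹U⁻¹), (x0|x3) = (V⁻¹U⁻¹|U)
  have s1 : l (U * V) + l U - b ≤ l (U * V * U) := by
    by_contra hc
    push Not at hc
    have e1 : (V⁻¹)⁻¹ * (U * V)⁻¹ = U⁻¹ := by group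
    have e2 : ((U * V)⁻¹)⁻¹ * U = U * V * U := by group
    have e3 : (V⁻¹)⁻¹ * U = V * U := by group
    have := h.four (b + 1) V⁻¹ (U * V)⁻¹ U (by rw [e1, h.inv, h.inv, h.inv]; linarith)
      (by rw [e2, h.inv]; linarith)
    rw [e3, h.inv] at this
    linarith
  have s2 : l (U * V * U) + l V - a ≤ l ((U * V) ^ 2) := by
    by_contra hc
    push Not at hc
    have e1 : (U⁻¹)⁻¹ * (U * V * U)⁻¹ = (U * V)⁻¹ := by group
    have e2 : ((U * V * U)⁻¹)⁻¹ * V = (U * V) ^ 2 := by rw [pow_two]; group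
    have e3 : (U⁻¹)⁻¹ * V = U * V := by group
    have := h.four (a + 1) U⁻¹ (U * V * U)⁻¹ V (by rw [e1, h.inv, h.inv, h.inv]; linarith)
      (by rw [e2, h.inv]; linarith)
    rw [e3, h.inv] at this
    linarith
  linarith

theorem final_pieces (h : TreeLen H l) (U V : H) (L M N : ℤ) (hL : 0 < L) (hM : 2 ≤ M)
    (hN : 2 ≤ N) (hU : N * L ≤ l U) (hV : M * L ≤ l V)
    (hUV : l U + l V - (2 * L - 1) ≤ l (U * V)) (hVU : l U + l V - (2 * L - 1) ≤ l (V * U))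
    (D u : H) (hD : D = u⁻¹ * (U * V) * u) : (M + N - 4) * L < l D := by
  have hU' : 2 * L ≤ l U := by nlinarith
  have hV' : 2 * L ≤ l V := by nlinarith
  have h1 := h.two_pieces U V _ _ hUV hVU (by linarith) (by linarith) (by linarith) (by linarith)
  have h2 := h.conj_le (U * V) u (by linarith)
  rw [hD]
  nlinarith

theorem pow_eq (h : TreeLen H l) (A : H) (hA2 : l (A ^ 2) = 2 * l A) (hpos : 0 < l A) (n : ℕ) :
    l (A ^ n) = n * l A := by
  have h1 := h.growth_mul A (by linarith) n
  have h2 := h.pow_le A n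
  rw [hA2] at h1
  linarith

theorem conj_pow_eq (h : TreeLen H l) (A u : H) (hA2 : l (A ^ 2) = 2 * l A) (hpos : 0 < l A)
    (hu : l (u⁻¹ * A * u) = l A) (n : ℕ) : l ((u⁻¹ * A * u) ^ n) = n * l A := by
  rcases Nat.eq_zero_or_pos n with rfl | hn
  · simp [h.one]
  have h2 := h.pow_le (u⁻¹ * A * u) n
  have e : (u⁻¹ * A * u) ^ n = u⁻¹ * A ^ n * u := by
    have := conj_pow (a := u⁻¹) (b := A) (i := n)
    simpa using this
  have h3 := h.pow_eq A hA2 hpos n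
  have h4 := h.pow_eq A hA2 hpos (n * 2)
  rw [pow_mul] at h4
  push_cast at h4
  have hn' : (0 : ℤ) < n := by exact_mod_cast hn
  have h5 := h.conj_le (A ^ n) u (by nlinarith)
  rw [hu] at h2
  rw [e] at h2 ⊢
  linarith

/-- Data: `P` is cyclically reduced of length `L`. -/
def Cyc (l : H → ℤ) (L : ℤ) (P : H) : Prop := 0 < L ∧ l P = L ∧ l (P ^ 2) = 2 * L

theorem Cyc.inv (h : TreeLen H l) {L : ℤ} {P : H} (hP : Cyc l L P) : Cyc l L P⁻¹ := by
  obtain ⟨h1, h2, h3⟩ := hP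
  exact ⟨h1, by rw [h.inv, h2], by rw [inv_pow, h.inv, h3]⟩

theorem Cyc.pow (h : TreeLen H l) {L : ℤ} {P : H} (hP : Cyc l L P) (n : ℕ) :
    l (P ^ n) = n * L := by
  obtain ⟨h1, h2, h3⟩ := hP
  rw [h.pow_eq P (by rw [h3, h2]) (by rw [h2]; exact h1), h2]

theorem Cyc.inner (h : TreeLen H l) {L : ℤ} {P : H} (hP : Cyc l L P) (n : ℕ) (hn : 1 ≤ n) :
    l P + l (P ^ n) - l (P⁻¹ * P ^ n) = 2 * L := by
  obtain ⟨m, rfl⟩ := Nat.exists_eq_add_of_le' hn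
  have : P⁻¹ * P ^ (m + 1) = P ^ m := by rw [pow_succ']; group
  rw [this, hP.pow h, hP.pow h, hP.2.1]
  push_cast
  ring

/-- Rotation by one letter. -/
theorem Cyc.rot (h : TreeLen H l) {L : ℤ} {P s : H} (hP : Cyc l L P) (hs : l s = 1)
    (hsP : l (s⁻¹ * P) = l P - 1) : Cyc l L (s⁻¹ * P * s) := by
  obtain ⟨h1, h2, h3⟩ := hP
  have t := h.tri (s⁻¹ * P) s
  have c := h.conj_le P s (by linarith)
  have e : l (s⁻¹ * P * s) = l P := by linarith
  have := h.conj_pow_eq P s (by linarith) (by linarith) e 2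
  refine ⟨h1, by linarith, ?_⟩
  rw [this, h2]; norm_num

/-- minimality of `k` among double rotations -/
def Mini (l : H → ℤ) (L : ℤ) (P Q k : H) : Prop :=
  ∀ u v, Cyc l L (u⁻¹ * P * u) → Cyc l L (v⁻¹ * Q * v) → l k ≤ l (u⁻¹ * k * v)

theorem Mini.swap (h : TreeLen H l) {L : ℤ} {P Q k : H} (hm : Mini l L P Q k) :
    Mini l L Q P k⁻¹ := by
  intro u v hu hv
  have := hm v u hv hu
  rw [h.inv, ← h.inv (u⁻¹ * k⁻¹ * v)]
  have e : (u⁻¹ * k⁻¹ * v)⁻¹ = v⁻¹ * k * u := by group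
  rwa [e]

theorem cyc_conj_inv (h : TreeLen H l) {L : ℤ} {Q s : H} (hh : Cyc l L (s⁻¹ * Q⁻¹ * s)) :
    Cyc l L (s⁻¹ * Q * s) := by
  have := hh.inv h
  have e : (s⁻¹ * Q⁻¹ * s)⁻¹ = s⁻¹ * Q * s := by group
  rwa [e] at this

/-- common first letter of `x` and a positive power -/
theorem first_letter (h : TreeLen H l) {L : ℤ} {Q x : H} (hQ : Cyc l L Q) (n : ℕ) (hn : 1 ≤ n)
    (hc : 2 ≤ l x + l (Q ^ n) - l (x⁻¹ * Q ^ n)) :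
    ∃ s, l s = 1 ∧ l (s⁻¹ * x) = l x - 1 ∧ l (s⁻¹ * Q ^ n) = l (Q ^ n) - 1 ∧
      Cyc l L (s⁻¹ * Q * s) := by
  have hx : x ≠ 1 := by
    rintro rfl
    simp [h.one] at hc
  obtain ⟨s, hs, hsx⟩ := h.pre x hx
  have hin := hQ.inner h n hn
  have hL := hQ.1
  have h1 := h.four 2 s x (Q ^ n) (by rw [hs, hsx]; linarith) hc
  have h2 := h.four 2 s (Q ^ n) Q h1 (by rw [h.symm (Q ^ n) Q]; linarith)
  have t1 := h.tri s (s⁻¹ * Q ^ n)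
  have t2 := h.tri s (s⁻¹ * Q)
  rw [mul_inv_cancel_left] at t1 t2
  exact ⟨s, hs, hsx, by linarith, hQ.rot h hs (by linarith)⟩

/-- first claim: minimal `k` has little cancellation with powers of `P`. -/
theorem claim1 (h : TreeLen H l) {L : ℤ} {P Q k : H} (hP : Cyc l L P) (hQ : Cyc l L Q)
    (hm : Mini l L P Q k) (n : ℕ) (hn : 1 ≤ n) :
    l k + l (P ^ n) - l (k⁻¹ * P ^ n) ≤ 1 := by
  by_contra hc
  obtain ⟨s, hs, hsk, -, hr⟩ := first_letter h hP n hn (x := k) (by linarith)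
  have := hm s 1 hr (by simpa using hQ)
  rw [mul_one] at this
  linarith

theorem Mini.inv_left (h : TreeLen H l) {L : ℤ} {P Q k : H} (hm : Mini l L P Q k) :
    Mini l L P⁻¹ Q k := fun u v hu hv => hm u v (cyc_conj_inv h hu) hv

theorem Mini.inv_right (h : TreeLen H l) {L : ℤ} {P Q k : H} (hm : Mini l L P Q k) :
    Mini l L P Q⁻¹ k := fun u v hu hv => hm u v hu (cyc_conj_inv h hv)

/-- second claim: `V = k⁻¹ P ^ m` and `Q ^ n` have little cancellation. -/
theorem claim2 (h : TreeLen H l) {L : ℤ} {P Q k : H} (hP : Cyc l L P) (hQ : Cyc l L Q)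
    (hm : Mini l L P Q k) (hk : 1 ≤ l k) (m n : ℕ) (hm1 : 1 ≤ m) (hn : 1 ≤ n) :
    l (k⁻¹ * P ^ m) + l (Q ^ n) - l ((k⁻¹ * P ^ m)⁻¹ * Q ^ n) ≤ 1 := by
  by_contra hc
  obtain ⟨s, hs, hsV, hsQ, hr⟩ := first_letter h hQ n hn (x := k⁻¹ * P ^ m) (by linarith)
  have c1 := claim1 h hP hQ hm m hm1
  have c2 := claim1 h hQ hP (hm.swap h) n hn
  have hsk : l s + l k⁻¹ - l (s⁻¹ * k⁻¹) ≤ 1 := by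
    by_contra h'
    have e := h.symm k⁻¹ s
    have := h.four 2 k⁻¹ s (Q ^ n) (by rw [e]; linarith) (by linarith)
    linarith
  have hV : l (k⁻¹ * P ^ m) ≤ l (P ^ m) - l k + 1 := by
    by_contra h'
    have e : (k⁻¹ * P ^ m)⁻¹ * k⁻¹ = (P ^ m)⁻¹ := by group
    have := h.four 2 s (k⁻¹ * P ^ m) k⁻¹ (by linarith) (by rw [e, h.inv, h.inv]; linarith)
    linarith
  have hks := hm 1 s (by simpa using hP) hr
  rw [inv_one, one_mul] at hks
  have hk1 : l k = 1 := by linarith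
  -- cancellation of `k * s` with `P ^ m`
  have e : (k * s)⁻¹ * P ^ m = s⁻¹ * (k⁻¹ * P ^ m) := by group
  have c3 : l (k * s) + l (P ^ m) - l ((k * s)⁻¹ * P ^ m) ≤ 1 := by
    by_contra h'
    obtain ⟨t, ht, htk, htP, htr⟩ := first_letter h hP m hm1 (x := k * s) (by linarith)
    have m1 := hm t s htr hr
    rw [mul_assoc] at m1
    have m2 := h.tri k s
    have hks2 : l (k * s) = 2 := by linarith
    have e2 : k⁻¹ * (k * s) = s := by group
    have := h.four 2 k (k * s) (P ^ m) (by rw [e2]; linarith) (by linarith)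
    linarith
  rw [e, hsV] at c3
  linarith

theorem main (h : TreeLen H l) (A g D u₀ : H) (hA2 : l (A ^ 2) = 2 * l A)
    (hcomm : ¬ Commute A (g * A * g⁻¹)) (M N : ℕ) (hM : 2 ≤ M) (hN : 2 ≤ N)
    (hD : D = u₀⁻¹ * (A ^ M * (g * A * g⁻¹) ^ N) * u₀) :
    ((M : ℤ) + N - 4) * l A < l D := by
  have hA0 : 0 < l A := by
    by_contra h'
    have := h.eq_one A (by linarith)
    subst this
    exact hcomm (Commute.one_left _)
  have hA : Cyc l (l A) A := ⟨hA0, rfl, hA2⟩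
  generalize hL : l A = L at *
  -- choose the minimal pair
  have hex : ∃ n : ℕ, ∃ u v, Cyc l L (u⁻¹ * A * u) ∧ Cyc l L (v⁻¹ * A * v) ∧
      l (u⁻¹ * g * v) = n := by
    obtain ⟨n, hn⟩ := Int.eq_ofNat_of_zero_le (h.nonneg g)
    exact ⟨n, 1, 1, by simpa using hA, by simpa using hA, by simpa using hn⟩
  classical
  obtain ⟨u, v, hP, hQ, huv⟩ := Nat.find_spec hex
  have hmin := fun m => Nat.find_min' hex (m := m)
  set n₀ := Nat.find hex
  obtain ⟨P, hPe⟩ : ∃ P, P = u⁻¹ * A * u := ⟨_, rfl⟩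
  obtain ⟨Q, hQe⟩ : ∃ Q, Q = v⁻¹ * A * v := ⟨_, rfl⟩
  obtain ⟨k, hke⟩ : ∃ k, k = u⁻¹ * g * v := ⟨_, rfl⟩
  rw [← hPe] at hP
  rw [← hQe] at hQ
  rw [← hke] at huv
  have hm : Mini l L P Q k := by
    intro x y hx hy
    obtain ⟨m, hm⟩ := Int.eq_ofNat_of_zero_le (h.nonneg (x⁻¹ * k * y))
    have := hmin m ⟨u * x, v * y, ?_, ?_, ?_⟩
    · rw [huv, hm]; exact_mod_cast this
    · convert hx using 1; rw [hPe]; group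
    · convert hy using 1; rw [hQe]; group
    · rw [← hm, hke]; congr 1; group
  have hAP : A = u * P * u⁻¹ := by rw [hPe]; group
  have hBQ : g * A * g⁻¹ = u * (k * Q * k⁻¹) * u⁻¹ := by rw [hQe, hke]; group
  have hDk : D = (u⁻¹ * u₀)⁻¹ * (P ^ M * (k * Q ^ N * k⁻¹)) * (u⁻¹ * u₀) := by
    rw [hD, hBQ, hAP, conj_pow, conj_pow, conj_pow]; group
  have hM' : (2 : ℤ) ≤ M := by exact_mod_cast hM
  have hN' : (2 : ℤ) ≤ N := by exact_mod_cast hN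
  have hPM := hP.pow h M
  have hQN := hQ.pow h N
  have hPM' := (hP.inv h).pow h M
  have hQN' := (hQ.inv h).pow h N
  have hcomm' : ¬ Commute P (k * Q * k⁻¹) := by
    intro hc
    apply hcomm
    rw [hBQ, hAP]
    have := hc.map (MulAut.conj u).toMonoidHom
    simpa [mul_assoc] using this
  by_cases hk0 : l k ≤ 0
  · have hk1 := h.eq_one k hk0
    subst hk1
    have key : ∀ (R S : H) (a b : ℕ), Cyc l L R → Cyc l L S → R⁻¹ * S ≠ 1 → 1 ≤ a → 1 ≤ b →
        l (R ^ a) + l (S ^ b) - l ((R ^ a)⁻¹ * S ^ b) ≤ 2 * L - 1 := by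
      intro R S a b hR hS hne ha hb
      by_contra hc
      have i1 := hR.inner h a ha
      have i2 := hS.inner h b hb
      have h1 := h.four (2 * L) R (R ^ a) (S ^ b) (by linarith) (by linarith)
      have h2 := h.four (2 * L) R (S ^ b) S h1 (by rw [h.symm (S ^ b) S]; linarith)
      exact hne (h.eq_one _ (by linarith [hR.2.1, hS.2.1]))
    have hne : P * Q ≠ 1 := by
      intro hc
      apply hcomm'
      rw [eq_inv_of_mul_eq_one_right hc]
      simp
    have hne' : Q * P ≠ 1 := by
      intro hc
      apply hcomm'
      rw [eq_inv_of_mul_eq_one_left hc]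
      simp
    have k1 := key P⁻¹ Q M N (hP.inv h) hQ (by simpa using hne) (by omega) (by omega)
    have k2 := key Q⁻¹ P N M (hQ.inv h) hP (by simpa using hne') (by omega) (by omega)
    rw [inv_pow, inv_inv, h.inv] at k1 k2
    refine h.final_pieces (P ^ M) (Q ^ N) L N M hP.1 hN' hM' (by linarith) (by linarith)
      (by linarith) (by linarith) D (u⁻¹ * u₀) (by rw [hDk]; simp) |>.trans_eq' ?_
    ring
  · push Not at hk0
    have hL1 : 1 ≤ L := hP.1
    have c1 := claim1 h hP hQ hm M (by omega)
    have c2 := claim1 h hQ hP (hm.swap h) N (by omega)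
    rw [inv_inv, h.inv] at c2
    have c3 := claim1 h (hP.inv h) hQ (hm.inv_left h) M (by omega)
    have c4 := claim1 h (hQ.inv h) hP ((hm.inv_right h).swap h) N (by omega)
    rw [inv_inv, h.inv] at c4
    have NL : 2 * L ≤ N * L := by nlinarith
    have ML : 2 * L ≤ M * L := by nlinarith
    -- general final estimate
    have key : ∀ (R S j : H) (a b : ℕ), Cyc l L R → Cyc l L S → Mini l L R S j → 0 < l j →
        2 ≤ a → 2 ≤ b →
        l (j⁻¹ * R ^ a) + l (j * S ^ b) - l ((j * S ^ b) * (j⁻¹ * R ^ a)) ≤ 1 := by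
      intro R S j a b hR hS hmj hj ha hb
      have q1 := claim2 h hR (hS.inv h) (hmj.inv_right h) hj a b (by omega) (by omega)
      have q2 := claim1 h hS hR (hmj.swap h) b (by omega)
      rw [inv_inv, h.inv] at q2
      have p1 := (hS.inv h).pow h b
      have p2 := hS.pow h b
      have bL : 2 * L ≤ b * L := by
        have : (2 : ℤ) ≤ b := by exact_mod_cast hb
        nlinarith
      by_contra hc
      have e1 : (S⁻¹ ^ b)⁻¹ * (j * S ^ b)⁻¹ = j⁻¹ := by rw [inv_pow]; group
      have e2 : ((j * S ^ b)⁻¹)⁻¹ * (j⁻¹ * R ^ a) = j * S ^ b * (j⁻¹ * R ^ a) := by group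
      have := h.four 2 (S⁻¹ ^ b) (j * S ^ b)⁻¹ (j⁻¹ * R ^ a)
        (by rw [e1, h.inv, h.inv]; linarith) (by rw [e2, h.inv]; linarith)
      rw [h.symm (S⁻¹ ^ b)] at this
      linarith
    have k1 := key P Q k M N hP hQ hm hk0 hM hN
    have k2 := key Q P k⁻¹ N M hQ hP (hm.swap h) (by rwa [h.inv]) hN hM
    rw [inv_inv] at k2
    refine h.final_pieces (k * Q ^ N) (k⁻¹ * P ^ M) L M N hP.1 hM' hN' (by linarith) (by linarith)
      (by linarith) (by linarith) D ((P ^ M)⁻¹ * (u⁻¹ * u₀)) ?_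
    rw [hDk]; group

end TreeLen

section Words

variable {ι : Type*} {G : ι → Type*} [∀ i, Group (G i)]

/-- reduced lists -/
def RedList (w : List (Σ i, G i)) : Prop :=
  (∀ x ∈ w, x.2 ≠ 1) ∧ w.IsChain (fun a b => a.1 ≠ b.1)

/-- product of a list -/
def lprod (w : List (Σ i, G i)) : CoprodI G :=
  (w.map fun x => CoprodI.of x.2).prod

theorem syl_lprod (w : List (Σ i, G i)) (hw : RedList w) :
    syllableLength G (lprod w) = w.length := by
  classical
  have h1 : lprod w = (CoprodI.Word.mk w hw.1 hw.2).prod := rfl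
  have h2 : CoprodI.Word.equiv (CoprodI.Word.mk w hw.1 hw.2).prod = CoprodI.Word.mk w hw.1 hw.2 :=
    CoprodI.Word.equiv.apply_symm_apply _
  rw [h1]
  unfold syllableLength
  have h3 := congrArg (fun z => z.toList.length) h2
  convert h3

theorem exists_red (A : CoprodI G) : ∃ w, RedList w ∧ lprod w = A := by
  classical
  exact ⟨(CoprodI.Word.equiv A).toList,
    ⟨(CoprodI.Word.equiv A).ne_one, (CoprodI.Word.equiv A).chain_ne⟩,
    CoprodI.Word.equiv.symm_apply_apply A⟩

/-- inverse list -/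
def linv (w : List (Σ i, G i)) : List (Σ i, G i) :=
  (w.map fun x => (⟨x.1, x.2⁻¹⟩ : Σ i, G i)).reverse

theorem lprod_nil : lprod ([] : List (Σ i, G i)) = 1 := rfl

theorem lprod_cons (a : Σ i, G i) (w : List (Σ i, G i)) :
    lprod (a :: w) = CoprodI.of a.2 * lprod w := by simp [lprod]

theorem lprod_append (v w : List (Σ i, G i)) : lprod (v ++ w) = lprod v * lprod w := by
  simp [lprod]

theorem linv_cons (a : Σ i, G i) (w : List (Σ i, G i)) :
    linv (a :: w) = linv w ++ [⟨a.1, a.2⁻¹⟩] := by simp [linv]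

theorem lprod_linv (w : List (Σ i, G i)) : lprod (linv w) = (lprod w)⁻¹ := by
  induction w with
  | nil => simp [linv, lprod]
  | cons a w ih =>
    rw [linv_cons, lprod_append, ih, lprod_cons, lprod_cons, lprod_nil]
    simp

theorem length_linv (w : List (Σ i, G i)) : (linv w).length = w.length := by simp [linv]

theorem RedList.linv {w : List (Σ i, G i)} (hw : RedList w) : RedList (linv w) := by
  refine ⟨?_, ?_⟩
  · intro x hx
    simp only [_root_.linv, List.mem_reverse, List.mem_map] at hx
    obtain ⟨y, hy, rfl⟩ := hx
    simpa using hw.1 y hy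
  · unfold _root_.linv
    rw [List.isChain_reverse, List.isChain_map]
    exact hw.2.imp (fun a b h => h.symm)

theorem RedList.tail {a : Σ i, G i} {w : List (Σ i, G i)} (hw : RedList (a :: w)) : RedList w :=
  ⟨fun x hx => hw.1 x (List.mem_cons_of_mem _ hx), hw.2.tail⟩

theorem RedList.append {v w : List (Σ i, G i)} (hv : RedList v) (hw : RedList w)
    (hvw : ∀ x ∈ v.getLast?, ∀ y ∈ w.head?, x.1 ≠ y.1) : RedList (v ++ w) := by
  refine ⟨?_, ?_⟩
  · intro x hx
    rcases List.mem_append.1 hx with hx | hx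
    · exact hv.1 x hx
    · exact hw.1 x hx
  · exact List.isChain_append.2 ⟨hv.2, hw.2, hvw⟩

theorem getLast_linv (w : List (Σ i, G i)) :
    (linv w).getLast? = w.head?.map fun x => (⟨x.1, x.2⁻¹⟩ : Σ i, G i) := by
  simp [linv]

open Classical in
/-- twice the Gromov product -/
noncomputable def cp : List (Σ i, G i) → List (Σ i, G i) → ℤ
  | a :: v, b :: w => if a = b then 2 + cp v w else if a.1 = b.1 then 1 else 0
  | [], _ => 0
  | _ :: _, [] => 0

theorem cp_nonneg (v w : List (Σ i, G i)) : 0 ≤ cp v w := by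
  induction v generalizing w with
  | nil => simp [cp]
  | cons a v ih =>
    cases w with
    | nil => simp [cp]
    | cons b w =>
      have := ih w
      simp only [cp]
      split_ifs <;> omega

theorem cp_four (k : ℤ) (x y z : List (Σ i, G i)) (h1 : k ≤ cp x y) (h2 : k ≤ cp y z) :
    k ≤ cp x z := by
  induction x generalizing y z k with
  | nil => simpa [cp] using h1
  | cons a x ih =>
    cases y with
    | nil =>
      have := cp_nonneg (a :: x) z
      simp only [cp] at h1
      omega
    | cons b y =>
      cases z with
      | nil => simpa [cp] using h2
      | cons c z =>
        have i := ih (k - 2) y z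
        have n1 := cp_nonneg x z
        simp only [cp] at h1 h2 ⊢
        by_cases hab : a = b
        · subst hab
          by_cases hbc : a = c
          · subst hbc
            simp only [if_true] at *
            have := i (by omega) (by omega)
            omega
          · simp only [if_neg hbc] at *
            exact h2
        · by_cases hbc : b = c
          · subst hbc
            simp only [if_neg hab] at *
            exact h1
          · simp only [if_neg hab, if_neg hbc] at h1 h2
            split_ifs at * <;> first | omega | (exfalso; simp_all)

theorem syl_cp (v w : List (Σ i, G i)) (hv : RedList v) (hw : RedList w) :
    (syllableLength G ((lprod v)⁻¹ * lprod w) : ℤ) = v.length + w.length - cp v w := by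
  induction v generalizing w with
  | nil => simp [lprod_nil, syl_lprod w hw, cp]
  | cons a v ih =>
    cases w with
    | nil =>
      rw [lprod_nil, mul_one, ← lprod_linv, syl_lprod _ hv.linv, length_linv]
      simp [cp]
    | cons b w =>
      by_cases hab : a = b
      · subst hab
        have := ih w hv.tail hw.tail
        simp only [cp, if_true]
        have e : (lprod (a :: v))⁻¹ * lprod (a :: w) = (lprod v)⁻¹ * lprod w := by
          rw [lprod_cons, lprod_cons]; group
        rw [e, this]
        simp only [List.length_cons]
        push_cast
        ring
      · by_cases hi : a.1 = b.1
        · obtain ⟨i, a⟩ := a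
          obtain ⟨j, b⟩ := b
          dsimp only at hi
          subst hi
          have hne : a⁻¹ * b ≠ 1 := by
            intro hc
            apply hab
            rw [inv_mul_eq_one.1 hc]
          have e : (lprod (⟨i, a⟩ :: v))⁻¹ * lprod (⟨i, b⟩ :: w) =
              lprod (linv v ++ (⟨i, a⁻¹ * b⟩ :: w)) := by
            rw [lprod_append, lprod_linv, lprod_cons, lprod_cons, lprod_cons]
            simp only [map_mul, map_inv]
            group
          have r1 : RedList ((⟨i, a⁻¹ * b⟩ : Σ i, G i) :: w) := by
            refine ⟨?_, ?_⟩
            · intro x hx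
              rcases List.mem_cons.1 hx with rfl | hx
              · exact hne
              · exact hw.1 x (List.mem_cons_of_mem _ hx)
            · have := hw.2
              rw [List.isChain_cons] at this ⊢
              exact this
          have r2 : RedList (linv v ++ ((⟨i, a⁻¹ * b⟩ : Σ i, G i) :: w)) := by
            refine hv.tail.linv.append r1 ?_
            intro x hx y hy
            rw [getLast_linv] at hx
            have hc := hv.2
            rw [List.isChain_cons] at hc
            simp only [List.head?_cons, Option.mem_def, Option.some.injEq] at hy
            subst hy
            simp only [Option.mem_def, Option.map_eq_some_iff] at hx
            obtain ⟨z, hz, rfl⟩ := hx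
            exact (hc.1 z hz).symm
          rw [e, syl_lprod _ r2]
          simp only [cp, if_neg hab, if_true, List.length_append, length_linv, List.length_cons]
          push_cast
          ring
        · have r2 : RedList (linv (a :: v) ++ (b :: w)) := by
            refine hv.linv.append hw ?_
            intro x hx y hy
            rw [getLast_linv] at hx
            simp only [List.head?_cons, Option.mem_def, Option.some.injEq,
              Option.map_some] at hx hy
            subst hx hy
            exact hi
          rw [← lprod_linv, ← lprod_append, syl_lprod _ r2]
          simp only [cp, if_neg hab, if_neg hi, List.length_append, length_linv, List.length_cons]
          push_cast
          ring

theorem treeLen : TreeLen (CoprodI G) (fun x => (syllableLength G x : ℤ)) where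
  one := by
    have := syl_lprod ([] : List (Σ i, G i)) ⟨by simp, by simp⟩
    rw [lprod_nil] at this
    simp [this]
  eq_one x hx := by
    obtain ⟨w, hw, rfl⟩ := exists_red x
    rw [syl_lprod w hw] at hx
    have : w = [] := List.length_eq_zero_iff.1 (by omega)
    rw [this, lprod_nil]
  inv x := by
    obtain ⟨w, hw, rfl⟩ := exists_red x
    rw [← lprod_linv, syl_lprod w hw, syl_lprod _ hw.linv, length_linv]
  four k x y z h1 h2 := by
    obtain ⟨x, hx, rfl⟩ := exists_red x
    obtain ⟨y, hy, rfl⟩ := exists_red y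
    obtain ⟨z, hz, rfl⟩ := exists_red z
    rw [syl_cp _ _ hx hy, syl_lprod x hx, syl_lprod y hy] at h1
    rw [syl_cp _ _ hy hz, syl_lprod y hy, syl_lprod z hz] at h2
    rw [syl_cp _ _ hx hz, syl_lprod x hx, syl_lprod z hz]
    have := cp_four k x y z (by linarith) (by linarith)
    linarith
  pre x hx := by
    obtain ⟨w, hw, rfl⟩ := exists_red x
    cases w with
    | nil => exact absurd lprod_nil hx
    | cons a w =>
      refine ⟨lprod [a], ?_, ?_⟩
      · rw [syl_lprod [a] ⟨?_, ?_⟩]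
        · simp
        · intro y hy
          exact hw.1 y (by simp at hy; simp [hy])
        · simp
      · have e : (lprod [a])⁻¹ * lprod (a :: w) = lprod w := by
          rw [lprod_cons, lprod_cons, lprod_nil]; group
        rw [e, syl_lprod _ hw, syl_lprod _ hw.tail]
        simp

theorem cyc_sq [∀ i, Finite (G i)] (A : CoprodI G) (hA : IsCyclicallyReduced G A)
    (hinf : ¬ IsOfFinOrder A) : syllableLength G (A ^ 2) = 2 * syllableLength G A := by
  classical
  obtain ⟨w, hw, rfl⟩ := exists_red A
  have h2 : CoprodI.Word.equiv (lprod w) = CoprodI.Word.mk w hw.1 hw.2 :=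
    CoprodI.Word.equiv.apply_symm_apply (CoprodI.Word.mk w hw.1 hw.2)
  have hA' : w.length ≤ 1 ∨ ∃ hd ∈ w.head?, ∃ lst ∈ w.getLast?, hd.1 ≠ lst.1 := by
    unfold IsCyclicallyReduced at hA
    have h3 : (CoprodI.Word.equiv (lprod w)).toList = w := by rw [h2]
    have hA2 : (CoprodI.Word.equiv (lprod w)).toList.length ≤ 1 ∨
      ∃ hd ∈ (CoprodI.Word.equiv (lprod w)).toList.head?,
        ∃ lst ∈ (CoprodI.Word.equiv (lprod w)).toList.getLast?, hd.1 ≠ lst.1 := by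
      convert hA
    rwa [h3] at hA2
  rcases hA' with h1 | ⟨hd, hhd, lst, hlst, hne⟩
  · exfalso
    apply hinf
    match w, h1 with
    | [], _ => rw [lprod_nil]; exact IsOfFinOrder.one
    | [a], _ =>
      rw [lprod_cons, lprod_nil, mul_one]
      exact MonoidHom.isOfFinOrder (CoprodI.of) (isOfFinOrder_of_finite a.2)
  · have r : RedList (w ++ w) := by
      refine hw.append hw ?_
      intro x hx y hy
      have e1 := Option.mem_unique hx hlst
      have e2 := Option.mem_unique hy hhd
      subst e1 e2
      exact hne.symm
    rw [pow_two, ← lprod_append, syl_lprod _ r, syl_lprod _ hw]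
    simp only [List.length_append]
    ring

end Words

/-- If `A` is cyclically reduced of infinite order, `A` and `gAg⁻¹` do not commute,
and `D` is a cyclically reduced element conjugate to `A^{N₁} (gAg⁻¹)^{N₂}` with
`N₁, N₂ ≥ 2`, then `|D| > (N₁ + N₂ − 4)|A|`. -/
theorem syllable_length_estimate {ι : Type*} [Fintype ι]
    (G : ι → Type*) [∀ i, Group (G i)] [∀ i, Finite (G i)] [∀ i, Nontrivial (G i)]
    (A g D : CoprodI G)
    (hA : IsCyclicallyReduced G A) (hAinf : ¬ IsOfFinOrder A)
    (hcomm : ¬ Commute A (g * A * g⁻¹))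
    (N₁ N₂ : ℕ) (hN₁ : 2 ≤ N₁) (hN₂ : 2 ≤ N₂)
    (hD : IsCyclicallyReduced G D)
    (hconj : IsConj (A ^ N₁ * (g * A * g⁻¹) ^ N₂) D) :
    (N₁ + N₂ - 4) * syllableLength G A < syllableLength G D := by
  obtain ⟨c, hc⟩ := isConj_iff.1 hconj
  have h2 := cyc_sq A hA hAinf
  have := (treeLen (G := G)).main A g D c⁻¹ (by exact_mod_cast h2) hcomm N₁ N₂ hN₁ hN₂
    (by rw [inv_inv]; exact hc.symm)
  have h4 : 4 ≤ N₁ + N₂ := by omega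
  zify [h4]
  exact this
end

section
/- Let G = G₁ * ⋯ * Gₙ be a free product of nontrivial finite groups, let H₁, H₂ be subgroups of one free factor Gᵢ, and suppose there exist f ∈ Gᵢ and k₁, k₂ ∈ ℕ with f^{k₁} ∈ H₁ \ {1} and f^{k₂} ∈ H₂ \ {1}. Then for any g ∈ G the subgroup H₁ * (gH₂g⁻¹) is not verbally closed in G. -/
open Monoid

/-- A subgroup `H` of `G` is *verbally closed* if every coefficient-free equation
`w(x₁,…,xₙ) = h` with `h ∈ H` that has a solution in `G` also has a solution in `H`. -/
def VerballyClosed {G : Type*} [Group G] (H : Subgroup G) : Prop :=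
  ∀ (n : ℕ) (w : FreeGroup (Fin n)) (h : G), h ∈ H →
    (∃ x : Fin n → G, FreeGroup.lift x w = h) →
    ∃ x : Fin n → G, (∀ i, x i ∈ H) ∧ FreeGroup.lift x w = h

/-- Any two nontrivial normal subgroups fail to commute elementwise. -/
def NoCommutingNormals (Q : Type*) [Group Q] : Prop :=
  ∀ N₁ N₂ : Subgroup Q, N₁.Normal → N₂.Normal → N₁ ≠ ⊥ → N₂ ≠ ⊥ →
    ∃ x ∈ N₁, ∃ y ∈ N₂, x * y ≠ y * x

lemma exists_common_kernel {L Q J : Type*} [Group L] [Group Q]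
    (hQ : NoCommutingNormals Q) [Nontrivial Q] (π : L →* Q) (hπ : Function.Surjective π)
    (ρ : J → (L →* Q)) (hρ : ∀ j, ¬ (ρ j).ker ≤ π.ker) (s : Finset J) :
    ∃ w, (∀ j ∈ s, ρ j w = 1) ∧ π w ≠ 1 := by
  classical
  induction s using Finset.induction_on with
  | empty =>
    obtain ⟨q, hq⟩ := exists_ne (1 : Q)
    obtain ⟨w, rfl⟩ := hπ q
    exact ⟨w, by simp, hq⟩
  | insert j s hj ih =>
    obtain ⟨w, hw, hw1⟩ := ih
    let K : Subgroup L := ⨅ j ∈ s, (ρ j).ker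
    have hKmem : ∀ x, x ∈ K ↔ ∀ j ∈ s, ρ j x = 1 := by
      intro x; simp [K, Subgroup.mem_iInf, MonoidHom.mem_ker]
    have hKn : K.Normal := by
      refine ⟨fun n hn g => ?_⟩
      rw [hKmem] at hn ⊢
      intro j hj
      simp [hn j hj]
    have h1 : K.map π ≠ ⊥ := by
      intro h
      have : π w ∈ K.map π := Subgroup.mem_map_of_mem π ((hKmem w).2 hw)
      rw [h] at this
      exact hw1 (Subgroup.mem_bot.1 this)
    have h2 : (ρ j).ker.map π ≠ ⊥ := by
      intro h
      exact hρ j ((Subgroup.map_eq_bot_iff _).1 h)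
    obtain ⟨x, hx, y, hy, hxy⟩ := hQ _ _ (hKn.map π hπ)
      ((MonoidHom.normal_ker (ρ j)).map π hπ) h1 h2
    obtain ⟨x, hx, rfl⟩ := hx
    obtain ⟨y, hy, rfl⟩ := hy
    refine ⟨x * y * x⁻¹ * y⁻¹, ?_, ?_⟩
    · intro k hk
      rcases Finset.mem_insert.1 hk with rfl | hk
      · have : ρ k y = 1 := hy
        simp [this]
      · have := (hKmem x).1 hx k hk
        simp [this]
    · intro h
      apply hxy
      simp only [map_mul, map_inv] at h
      rw [mul_inv_eq_one, mul_inv_eq_iff_eq_mul] at h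
      exact h

lemma VerballyClosed.fintype {G : Type*} [Group G] {H : Subgroup G} (hH : VerballyClosed H)
    {α : Type*} [Finite α] (w : FreeGroup α) (s : α → G) (hw : FreeGroup.lift s w ∈ H) :
    ∃ x : α → H, ((FreeGroup.lift x w : H) : G) = FreeGroup.lift s w := by
  obtain ⟨n, ⟨e⟩⟩ := Finite.exists_equiv_fin α
  have key : ∀ (y : α → G), FreeGroup.lift (y ∘ e.symm) (FreeGroup.map e w)
      = FreeGroup.lift y w := by
    intro y
    have : (FreeGroup.lift (y ∘ e.symm)).comp (FreeGroup.map e) = FreeGroup.lift y := by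
      ext a; simp
    rw [← this]; rfl
  obtain ⟨x, hx, hxw⟩ := hH n (FreeGroup.map e w) _ hw ⟨s ∘ e.symm, key s⟩
  refine ⟨fun a => ⟨x (e a), hx _⟩, ?_⟩
  rw [← hxw]
  have h1 : (H.subtype).comp (FreeGroup.lift (fun a => (⟨x (e a), hx _⟩ : H)))
      = (FreeGroup.lift x).comp (FreeGroup.map e) := by
    ext a; simp
  exact DFunLike.congr_fun h1 w

lemma VerballyClosed.exists_hom {G : Type*} [Group G] {H : Subgroup G} (hH : VerballyClosed H)
    {α : Type*} [Finite α] (s : α → G) (hs : H ≤ (FreeGroup.lift s).range)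
    {Q : Type*} [Group Q] [Finite Q] [Nontrivial Q] (hQ : NoCommutingNormals Q)
    (φ : H →* Q) (hφ : Function.Surjective φ) :
    ∃ θ : FreeGroup α →* Q, ∀ (w : FreeGroup α) (hw : FreeGroup.lift s w ∈ H),
      θ w = φ ⟨FreeGroup.lift s w, hw⟩ := by
  classical
  let S := FreeGroup.lift s
  let L := H.comap S
  let σ : L →* H := S.subgroupComap H
  have hσ : Function.Surjective σ := by
    rintro ⟨h, hh⟩
    obtain ⟨w, hw⟩ := hs hh
    refine ⟨⟨w, ?_⟩, Subtype.ext hw⟩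
    change S w ∈ H
    rw [show S w = h from hw]; exact hh
  let π := φ.comp σ
  have hπ : Function.Surjective π := hφ.comp hσ
  obtain ⟨x, hx⟩ : ∃ x : α → Q, ((FreeGroup.lift x).comp L.subtype).ker ≤ π.ker := by
    by_contra hcon
    push Not at hcon
    have := Fintype.ofFinite (α → Q)
    obtain ⟨w, hw, hw1⟩ := exists_common_kernel hQ π hπ
      (fun x : α → Q => (FreeGroup.lift x).comp L.subtype) hcon Finset.univ
    obtain ⟨x, hx⟩ := hH.fintype w.1 s w.2
    have h1 := hw (fun a => φ (x a)) (Finset.mem_univ _)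
    apply hw1
    have h2 : FreeGroup.lift (fun a => φ (x a)) = φ.comp (FreeGroup.lift x) := by
      ext a; simp
    have h3 : σ w = FreeGroup.lift x w.1 := Subtype.ext hx.symm
    change φ (σ w) = 1
    rw [h3, ← h1]
    change _ = FreeGroup.lift (fun a => φ (x a)) w.1
    rw [h2]; rfl
  set ρ := (FreeGroup.lift x).comp L.subtype with hρ
  -- the restricted map is onto `Q`
  have hρs : Function.Surjective ρ := by
    let τ := ρ.rangeRestrict
    have hτ : Function.Surjective τ := ρ.rangeRestrict_surjective
    have hk : τ.ker ≤ π.ker := by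
      rw [MonoidHom.ker_rangeRestrict]; exact hx
    let β := τ.liftOfSurjective hτ ⟨π, hk⟩
    have hβ : ∀ l, β (τ l) = π l := fun l => MonoidHom.liftOfRightInverse_comp_apply _ _ _ ⟨π, hk⟩ l
    have hβs : Function.Surjective β := by
      intro q
      obtain ⟨l, rfl⟩ := hπ q
      exact ⟨τ l, hβ l⟩
    have hc : Nat.card Q ≤ Nat.card ρ.range := Nat.card_le_card_of_surjective β hβs
    rw [← MonoidHom.range_eq_top]
    exact Subgroup.eq_top_of_le_card _ hc
  let β := ρ.liftOfSurjective hρs ⟨π, hx⟩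
  have hβ : ∀ l, β (ρ l) = π l := fun l => MonoidHom.liftOfRightInverse_comp_apply _ _ _ ⟨π, hx⟩ l
  exact ⟨β.comp (FreeGroup.lift x), fun w hw => hβ ⟨w, hw⟩⟩

lemma noCommutingNormals_of_prime {Q Ω : Type*} [Group Q] [MulAction Q Ω] [FaithfulSMul Q Ω]
    [MulAction.IsPretransitive Q Ω] (hp : (Nat.card Ω).Prime) (v : Q) (hv : v ≠ 1)
    (ω₁ ω₂ : Ω) (hω : ω₁ ≠ ω₂) (h₁ : v • ω₁ = ω₁) (h₂ : v • ω₂ = ω₂) :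
    NoCommutingNormals Q := by
  intro N₁ N₂ hN₁ hN₂ hb₁ hb₂
  by_contra hcon
  push Not at hcon
  have : MulAction.IsPreprimitive Q Ω := MulAction.IsPreprimitive.of_prime_card hp
  have htrans : ∀ N : Subgroup Q, N.Normal → N ≠ ⊥ → MulAction.IsPretransitive N Ω := by
    intro N hN hb
    apply MulAction.IsQuasiPreprimitive.isPretransitive_of_normal
    intro h
    apply hb
    rw [Subgroup.eq_bot_iff_forall]
    intro n hn
    apply FaithfulSMul.eq_of_smul_eq_smul (α := Ω)
    intro a
    have : a ∈ MulAction.fixedPoints N Ω := by rw [h]; trivial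
    simpa using this ⟨n, hn⟩
  have t₁ := htrans N₁ hN₁ hb₁
  have t₂ := htrans N₂ hN₂ hb₂
  have hfree : ∀ n ∈ N₂, ∀ a : Ω, n • a = a → n = 1 := by
    intro n hn a ha
    apply FaithfulSMul.eq_of_smul_eq_smul (α := Ω)
    intro c
    obtain ⟨m, hm⟩ := MulAction.exists_smul_eq N₁ a c
    have hm' : (m : Q) • a = c := hm
    rw [one_smul, ← hm', smul_smul, ← hcon m m.2 n hn, mul_smul, ha]
  have hcard : Nat.card N₂ = Nat.card Ω := by
    refine Nat.card_congr (Equiv.ofBijective (fun n : N₂ => (n : Q) • ω₁) ⟨?_, ?_⟩)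
    · intro n m hnm
      have h := hfree ((m : Q)⁻¹ * n) (N₂.mul_mem (N₂.inv_mem m.2) n.2) ω₁ (by
        rw [mul_smul]
        change (n : Q) • ω₁ = (m : Q) • ω₁ at hnm
        rw [hnm, inv_smul_smul])
      exact Subtype.ext (inv_mul_eq_one.1 h).symm
    · intro c
      obtain ⟨m, hm⟩ := MulAction.exists_smul_eq N₂ ω₁ c
      exact ⟨m, hm⟩
  obtain ⟨n, hn⟩ := MulAction.exists_smul_eq N₂ ω₁ ω₂
  have hn' : (n : Q) • ω₁ = ω₂ := hn
  have hn1 : n ≠ 1 := by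
    rintro rfl
    apply hω; simpa using hn'
  have hconj : v * n * v⁻¹ = n := by
    have h := hfree ((n : Q)⁻¹ * (v * n * v⁻¹))
      (N₂.mul_mem (N₂.inv_mem n.2) (hN₂.conj_mem _ n.2 v)) ω₁ (by
        have : v⁻¹ • ω₁ = ω₁ := by rw [inv_smul_eq_iff, h₁]
        rw [mul_smul, mul_smul, mul_smul, this, hn', h₂, ← hn', inv_smul_smul])
    exact (inv_mul_eq_one.1 h).symm
  have hcomm : v * n = n * v := by rwa [mul_inv_eq_iff_eq_mul] at hconj
  have : Fact (Nat.card N₂).Prime := ⟨by rw [hcard]; exact hp⟩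
  apply hv
  apply FaithfulSMul.eq_of_smul_eq_smul (α := Ω)
  intro c
  obtain ⟨m, hm⟩ := MulAction.exists_smul_eq N₂ ω₁ c
  have hm' : (m : Q) • ω₁ = c := hm
  obtain ⟨k, hk⟩ := mem_zpowers_of_prime_card (g := n) (g' := m) rfl hn1
  have hmk : (m : Q) = (n : Q) ^ k := by rw [← hk]; simp
  have hcm : v * m = m * v := by
    rw [hmk]; exact (Commute.zpow_right (show Commute v n from hcomm) k)
  rw [one_smul, ← hm', smul_smul, hcm, mul_smul, h₁]

lemma exists_hom_of_free {A G : Type*} [Group A] [Group G] (ι : A →* G)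
    (hι : Function.Injective ι) (H₁ H₂ : Subgroup A) (g : G)
    (hfp : Function.Injective (Coprod.lift
      (H₁.map ι).subtype (((H₂.map ι).map (MulAut.conj g).toMonoidHom).subtype)))
    {P : Type*} [Group P] (φ₁ : H₁ →* P) (φ₂ : H₂ →* P) :
    ∃ Φ : ↥(H₁.map ι ⊔ (H₂.map ι).map (MulAut.conj g).toMonoidHom) →* P,
      (∀ (h : H₁) hm, Φ ⟨ι h, hm⟩ = φ₁ h) ∧ (∀ (h : H₂) hm, Φ ⟨g * ι h * g⁻¹, hm⟩ = φ₂ h) := by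
  set T := H₁.map ι ⊔ (H₂.map ι).map (MulAut.conj g).toMonoidHom with hT
  set ψ := Coprod.lift
      (H₁.map ι).subtype (((H₂.map ι).map (MulAut.conj g).toMonoidHom).subtype) with hψ
  have hr : ψ.range = T := by
    rw [hψ, Coprod.range_lift, Subgroup.range_subtype, Subgroup.range_subtype]
  let e := MonoidHom.ofInjective hfp
  let e₁ := H₁.equivMapOfInjective ι hι
  let e₂ := (H₂.equivMapOfInjective ι hι).trans
    ((H₂.map ι).equivMapOfInjective (MulAut.conj g).toMonoidHom (MulAut.conj g).injective)
  let Φ₀ := Coprod.lift (φ₁.comp e₁.symm.toMonoidHom) (φ₂.comp e₂.symm.toMonoidHom)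
  let Φ : T →* P := Φ₀.comp (e.symm.toMonoidHom.comp (Subgroup.inclusion hr.ge))
  have key : ∀ c (hm : ψ c ∈ T), Φ ⟨ψ c, hm⟩ = Φ₀ c := by
    intro c hm
    change Φ₀ (e.symm ⟨ψ c, _⟩) = Φ₀ c
    congr 1
    rw [MulEquiv.symm_apply_eq]
    rfl
  refine ⟨Φ, fun h hm => ?_, fun h hm => ?_⟩
  · have h1 : ψ (Coprod.inl (e₁ h)) = ι h := rfl
    have := key (Coprod.inl (e₁ h)) (by rw [h1]; exact hm)
    simp only [h1] at this
    rw [this]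
    change φ₁ (e₁.symm (e₁ h)) = φ₁ h
    rw [e₁.symm_apply_apply]
  · have h1 : ψ (Coprod.inr (e₂ h)) = g * ι h * g⁻¹ := rfl
    have := key (Coprod.inr (e₂ h)) (by rw [h1]; exact hm)
    simp only [h1] at this
    rw [this]
    change φ₂ (e₂.symm (e₂ h)) = φ₂ h
    rw [e₂.symm_apply_apply]

lemma exists_params (m d p : ℕ) (hm : 2 ≤ m) (hd : 1 ≤ d) (hp : p.Prime) (hpm : p ∣ m) :
    ∃ t, 0 < t ∧ (1 + t * d * m).Prime ∧ ¬ p ∣ t := by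
  have hq : p * (d * m) ≠ 0 := by
    have := hp.pos
    positivity
  have hc1 : (1 + d * m).Coprime (d * m) := by simp
  have hc2 : (1 + d * m).Coprime p := Nat.Coprime.coprime_dvd_right (Dvd.dvd.mul_left hpm d) hc1
  obtain ⟨l, hl, hlp, hmod⟩ := Nat.forall_exists_prime_gt_and_modEq (1 + d * m) hq
    (Nat.Coprime.mul_right hc2 hc1)
  have hdvd := (Nat.modEq_iff_dvd' hl.le).1 hmod.symm
  obtain ⟨c, hc⟩ := hdvd
  refine ⟨1 + p * c, by omega, ?_, ?_⟩
  · have : 1 + (1 + p * c) * d * m = l := by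
      have : l = 1 + d * m + p * (d * m) * c := by omega
      rw [this]; ring
    rwa [this]
  · intro h
    have h2 : p ∣ 1 := (Nat.dvd_add_left (Dvd.intro c rfl)).1 h
    exact hp.one_lt.ne' (Nat.dvd_one.1 h2)

lemma exists_actions {A₁ A₂ S : Type*} [Group A₁] [Finite A₁] [Group A₂] [MulAction A₂ S]
    [Finite S] [MulAction.IsPretransitive A₂ S] (s₀ x₀ : S) (hx₀ : x₀ ≠ s₀) (c : A₁) (hc : c ≠ 1)
    (t : ℕ) (Ω : Type _)
    (hΩ : Ω = Option ((Fin t × {x : S // x ≠ s₀}) × A₁)) :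
    ∃ (φ₁ : A₁ →* Equiv.Perm Ω) (φ₂ : A₂ →* Equiv.Perm Ω) (ω₀ : Ω),
      (∀ h, h ≠ 1 → ∀ ω, φ₁ h ω = ω ↔ ω = ω₀) ∧
      (∀ b : A₂, (∀ x : S, b • x ≠ x) →
        Nat.card {ω // φ₂ b ω = ω} + t * Nat.card S = Nat.card Ω) ∧
      (∀ N : Subgroup (Equiv.Perm Ω), (∀ h, φ₁ h ∈ N) → (∀ h, φ₂ h ∈ N) →
        ∀ ω, ∃ n ∈ N, n ω₀ = ω) := by
  classical
  subst hΩ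
  let R := Fin t × {x : S // x ≠ s₀}
  let f₁ : A₁ →* Equiv.Perm (Option (R × A₁)) :=
    { toFun := fun h => Equiv.optionCongr ((Equiv.refl R).prodCongr (Equiv.mulLeft h))
      map_one' := by
        ext1 ω
        rcases ω with _ | ⟨r, a⟩ <;> simp
      map_mul' := by
        intro x y
        ext1 ω
        rcases ω with _ | ⟨r, a⟩ <;> simp [mul_assoc] }
  have f₁none : ∀ h, f₁ h none = none := fun h => rfl
  have f₁some : ∀ h r a, f₁ h (some (r, a)) = some (r, h * a) := fun h r a => rfl
  let ε : Fin t × S → Option (R × A₁) := fun z =>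
    if h : z.2 = s₀ then
      (if z.1.val = 0 then none else some ((⟨z.1.val - 1, by omega⟩, ⟨x₀, hx₀⟩), c))
    else some ((z.1, ⟨z.2, h⟩), 1)
  have ε0 : ∀ i : Fin t, i.val = 0 → ε (i, s₀) = none := by
    intro i hi; simp [ε, hi]
  have ε1 : ∀ i : Fin t, i.val ≠ 0 →
      ε (i, s₀) = some ((⟨i.val - 1, by omega⟩, ⟨x₀, hx₀⟩), c) := by
    intro i hi; simp [ε, hi]
  have ε2 : ∀ (i : Fin t) (x : S) (hx : x ≠ s₀), ε (i, x) = some ((i, ⟨x, hx⟩), 1) := by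
    intro i x hx; simp [ε, hx]
  have hε : Function.Injective ε := by
    rintro ⟨i, x⟩ ⟨j, y⟩ hxy
    by_cases hx : x = s₀ <;> by_cases hy : y = s₀
    · subst hx; subst hy
      by_cases hi : i.val = 0 <;> by_cases hj : j.val = 0
      · have : i = j := Fin.ext (by omega)
        rw [this]
      · rw [ε0 i hi, ε1 j hj] at hxy; simp at hxy
      · rw [ε1 i hi, ε0 j hj] at hxy; simp at hxy
      · rw [ε1 i hi, ε1 j hj] at hxy
        simp at hxy
        have : i = j := Fin.ext (by omega)
        rw [this]
    · subst hx
      rw [ε2 j y hy] at hxy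
      by_cases hi : i.val = 0
      · rw [ε0 i hi] at hxy; simp at hxy
      · rw [ε1 i hi] at hxy; simp [hc] at hxy
    · subst hy
      rw [ε2 i x hx] at hxy
      by_cases hj : j.val = 0
      · rw [ε0 j hj] at hxy; simp at hxy
      · rw [ε1 j hj] at hxy; simp [hc.symm] at hxy
    · rw [ε2 i x hx, ε2 j y hy] at hxy
      simpa using hxy
  let f₂' : A₂ →* Equiv.Perm (Fin t × S) :=
    { toFun := fun h => (Equiv.refl (Fin t)).prodCongr (MulAction.toPerm h)
      map_one' := by ext1 ⟨i, x⟩; simp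
      map_mul' := by intro a b; ext1 ⟨i, x⟩; simp [mul_smul] }
  let f₂ : A₂ →* Equiv.Perm (Option (R × A₁)) := (Equiv.Perm.viaEmbeddingHom ⟨ε, hε⟩).comp f₂'
  have f₂ε : ∀ h i x, f₂ h (ε (i, x)) = ε (i, h • x) := fun h i x =>
    Equiv.Perm.viaEmbedding_apply (f₂' h) ⟨ε, hε⟩ (i, x)
  have f₂n : ∀ h ω, ω ∉ Set.range ε → f₂ h ω = ω := fun h ω hω =>
    Equiv.Perm.viaEmbedding_apply_of_notMem (f₂' h) ⟨ε, hε⟩ ω hω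
  refine ⟨f₁, f₂, none, ?_, ?_, ?_⟩
  · intro h hh ω
    rcases ω with _ | ⟨r, a⟩
    · simp [f₁none]
    · rw [f₁some]; simp [hh]
  · intro b hb
    have hset : ∀ ω, f₂ b ω = ω ↔ ω ∉ Set.range ε := by
      intro ω
      refine ⟨?_, f₂n b ω⟩
      rintro h ⟨⟨i, x⟩, rfl⟩
      rw [f₂ε] at h
      exact hb x (Prod.ext_iff.1 (hε h)).2
    have h1 : Nat.card {ω // f₂ b ω = ω} = (Set.range ε)ᶜ.ncard := by
      rw [← Nat.card_coe_set_eq]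
      exact Nat.card_congr (Equiv.subtypeEquivRight hset)
    have h2 : (Set.range ε).ncard = t * Nat.card S := by
      rw [← Nat.card_coe_set_eq, Nat.card_range_of_injective hε]; simp
    rw [h1, ← h2, add_comm]
    exact Set.ncard_add_ncard_compl _
  · intro N hN₁ hN₂
    -- everything reachable
    have step1 : ∀ r a b, (∃ n ∈ N, n none = some (r, a)) → ∃ n ∈ N, n none = some (r, b) := by
      rintro r a b ⟨n, hn, hna⟩
      refine ⟨f₁ (b * a⁻¹) * n, N.mul_mem (hN₁ _) hn, ?_⟩
      rw [Equiv.Perm.mul_apply, hna, f₁some]; simp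
    have step2 : ∀ i x y, (∃ n ∈ N, n none = ε (i, x)) → ∃ n ∈ N, n none = ε (i, y) := by
      rintro i x y ⟨n, hn, hna⟩
      obtain ⟨h, rfl⟩ := MulAction.exists_smul_eq A₂ x y
      refine ⟨f₂ h * n, N.mul_mem (hN₂ _) hn, ?_⟩
      rw [Equiv.Perm.mul_apply, hna, f₂ε]
    have main : ∀ k (hk : k < t), ∃ n ∈ N, n none = ε (⟨k, hk⟩, s₀) := by
      intro k
      induction k with
      | zero => intro hk; exact ⟨1, N.one_mem, by rw [ε0 _ rfl]; rfl⟩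
      | succ k ih =>
        intro hk
        have h1 := step2 _ s₀ x₀ (ih (by omega))
        rw [ε2 _ _ hx₀] at h1
        have h2 := step1 _ _ c h1
        rw [ε1 _ (by simp)]
        exact h2
    intro ω
    rcases ω with _ | ⟨⟨i, x⟩, a⟩
    · exact ⟨1, N.one_mem, rfl⟩
    · have h1 := step2 i s₀ x (main i.1 i.2)
      rw [ε2 _ _ x.2] at h1
      exact step1 _ _ a h1

lemma card_fixed_modEq_one {Ω : Type*} [Finite Ω] (p : ℕ) (hp : p.Prime) (U Z : Equiv.Perm Ω)
    (hU : U ^ p = 1) (hUZ : Commute U Z) (ω₀ : Ω) (hω : ∀ ω, U ω = ω ↔ ω = ω₀) (hZ : Z ω₀ = ω₀) :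
    Nat.card {ω // Z ω = ω} ≡ 1 [MOD p] := by
  classical
  have := Fintype.ofFinite Ω
  have : Fact p.Prime := ⟨hp⟩
  have hmem : ∀ ω, Z ω = ω → Z (U ω) = U ω := by
    intro ω h
    have : (Z * U) ω = (U * Z) ω := by rw [hUZ.eq]
    simpa [h] using this
  let F : Function.End {ω // Z ω = ω} := fun ω => ⟨U ω, hmem _ ω.2⟩
  have hF : ∀ (k : ℕ) ω, ((F ^ k) ω : Ω) = (U ^ k) ω := by
    intro k
    induction k with
    | zero => intro ω; rfl
    | succ k ih =>
      intro ω
      rw [pow_succ, pow_succ, Equiv.Perm.mul_apply]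
      exact ih (F ω)
  have h1 : F ^ p ^ 1 = 1 := by
    funext ω
    apply Subtype.ext
    rw [hF, pow_one, hU]; rfl
  have h2 := Equiv.Perm.card_fixedPoints_modEq h1
  rw [Nat.card_eq_fintype_card]
  refine h2.trans ?_
  rw [show Fintype.card (Function.fixedPoints F) = 1 from ?_]
  rw [Fintype.card_eq_one_iff]
  refine ⟨⟨⟨ω₀, hZ⟩, Subtype.ext ((hω _).2 rfl)⟩, ?_⟩
  rintro ⟨⟨ω, h⟩, h'⟩
  have : U ω = ω := congrArg Subtype.val h'
  have := (hω ω).1 this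
  subst this; rfl

lemma not_verballyClosed_core {A : Type*} {G : Type*} [Group A] [Finite A] [Group G] (ι : A →* G)
    (hι : Function.Injective ι) (H₁ H₂ : Subgroup A) (g : G)
    (hfp : Function.Injective (Coprod.lift
      (H₁.map ι).subtype (((H₂.map ι).map (MulAut.conj g).toMonoidHom).subtype)))
    (f : A) (k₁ k₂ p : ℕ) (hp : p.Prime) (hf₁ : f ^ k₁ ∈ H₁) (hord : orderOf (f ^ k₁) = p)
    (hf₂ : f ^ k₂ ∈ H₂) (K : Subgroup H₂)
    (hfree : ∀ x : H₂ ⧸ K, (⟨f ^ k₂, hf₂⟩ : H₂) • x ≠ x)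
    (hor : k₁ = k₂ ∨ ¬ p ∣ Nat.card (H₂ ⧸ K))
    (hne : ¬ (Nat.card H₁ = 2 ∧ Nat.card (H₂ ⧸ K) = 2)) :
    ¬ VerballyClosed (H₁.map ι ⊔ (H₂.map ι).map (MulAut.conj g).toMonoidHom) := by
  intro hVC
  let a : H₁ := ⟨f ^ k₁, hf₁⟩
  let b : H₂ := ⟨f ^ k₂, hf₂⟩
  have ha : orderOf a = p := by rw [← hord]; exact (Subgroup.orderOf_coe a).symm
  have ha1 : a ≠ 1 := by
    intro h; rw [h, orderOf_one] at ha; exact hp.one_lt.ne ha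
  have hpm : p ∣ Nat.card H₁ := ha ▸ orderOf_dvd_natCard a
  let s₀ : H₂ ⧸ K := ((1 : H₂) : H₂ ⧸ K)
  have hx₀ : b • s₀ ≠ s₀ := hfree s₀
  have hm : 2 ≤ Nat.card H₁ := hp.two_le.trans (Nat.le_of_dvd Nat.card_pos hpm)
  have hs : 2 ≤ Nat.card (H₂ ⧸ K) := by
    have : Nontrivial (H₂ ⧸ K) := ⟨⟨_, _, hx₀⟩⟩
    exact Finite.one_lt_card
  obtain ⟨t, ht, hprime, hpt⟩ := exists_params (Nat.card H₁) (Nat.card (H₂ ⧸ K) - 1) p hm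
    (by omega) hp hpm
  let Ω := Option ((Fin t × {x : H₂ ⧸ K // x ≠ s₀}) × H₁)
  obtain ⟨φ₁, φ₂, ω₀, hφ₁, hφ₂, htr⟩ := exists_actions (A₂ := H₂) s₀ (b • s₀) hx₀ a ha1 t Ω rfl
  have hcard : Nat.card Ω = 1 + t * (Nat.card (H₂ ⧸ K) - 1) * Nat.card H₁ := by
    have : Nat.card {x : H₂ ⧸ K // x ≠ s₀} = Nat.card (H₂ ⧸ K) - 1 := by
      classical
      have := Fintype.ofFinite (H₂ ⧸ K)
      simp [Nat.card_eq_fintype_card, Fintype.card_subtype_compl]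
    simp only [Ω, Finite.card_option, Nat.card_prod, this, Nat.card_fin]
    ring
  have hfix := hφ₂ b hfree
  have hβ : 2 ≤ Nat.card {ω // φ₂ b ω = ω} := by
    obtain ⟨d, hd⟩ : ∃ d, Nat.card (H₂ ⧸ K) = d + 1 := ⟨Nat.card (H₂ ⧸ K) - 1, by omega⟩
    rw [hcard, hd] at hfix
    rw [hd] at hs hne
    simp only [Nat.add_sub_cancel] at hfix
    have h1 : d + 2 ≤ d * Nat.card H₁ := by
      by_cases h : d = 1
      · subst h; have : Nat.card H₁ ≠ 2 := fun h => hne ⟨h, rfl⟩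
        omega
      · have : d * 2 ≤ d * Nat.card H₁ := Nat.mul_le_mul_left d hm
        omega
    have h2 : t * (d + 2) ≤ t * (d * Nat.card H₁) := Nat.mul_le_mul_left t h1
    rw [mul_assoc] at hfix
    have h3 : t * (d + 2) = t * (d + 1) + t := by ring
    omega
  obtain ⟨Φ, hΦ₁, hΦ₂⟩ := exists_hom_of_free ι hι H₁ H₂ g hfp φ₁ φ₂
  have hT₁ : ∀ h : H₁, ι h ∈ H₁.map ι ⊔ (H₂.map ι).map (MulAut.conj g).toMonoidHom := fun h =>
    Subgroup.mem_sup_left (Subgroup.mem_map_of_mem ι h.2)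
  have hT₂ : ∀ h : H₂, g * ι h * g⁻¹ ∈ H₁.map ι ⊔ (H₂.map ι).map (MulAut.conj g).toMonoidHom :=
    fun h => Subgroup.mem_sup_right (Subgroup.mem_map_of_mem (MulAut.conj g).toMonoidHom
      (Subgroup.mem_map_of_mem ι h.2))
  have hQ₁ : ∀ h, φ₁ h ∈ Φ.range := fun h => ⟨_, hΦ₁ h (hT₁ h)⟩
  have hQ₂ : ∀ h, φ₂ h ∈ Φ.range := fun h => ⟨_, hΦ₂ h (hT₂ h)⟩
  have hpre : MulAction.IsPretransitive Φ.range Ω := by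
    have h0 := htr Φ.range hQ₁ hQ₂
    refine ⟨fun x y => ?_⟩
    obtain ⟨n, hn, rfl⟩ := h0 x
    obtain ⟨m, hm, rfl⟩ := h0 y
    refine ⟨⟨m, hm⟩ * ⟨n, hn⟩⁻¹, ?_⟩
    change (m * n⁻¹) (n ω₀) = m ω₀
    simp
  obtain ⟨⟨ω₁, h₁⟩, ⟨ω₂, h₂⟩, hω⟩ := Finite.one_lt_card_iff_nontrivial.1
    (show 1 < Nat.card {ω // φ₂ b ω = ω} by omega)
  have hv : (⟨φ₂ b, hQ₂ b⟩ : Φ.range) ≠ 1 := by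
    intro h
    have h1 : φ₂ b = 1 := congrArg Subtype.val h
    rw [h1] at hfix
    have : Nat.card {ω // (1 : Equiv.Perm Ω) ω = ω} = Nat.card Ω :=
      Nat.card_congr (Equiv.subtypeUnivEquiv (fun _ => rfl))
    have h2 : 0 < t * Nat.card (H₂ ⧸ K) := by positivity
    omega
  have hnon : Nontrivial Φ.range := ⟨⟨_, _, hv⟩⟩
  have hNC : NoCommutingNormals Φ.range :=
    noCommutingNormals_of_prime (Ω := Ω) (by rw [hcard]; exact hprime) ⟨φ₂ b, hQ₂ b⟩ hv ω₁ ω₂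
      (fun h => hω (Subtype.ext h)) h₁ h₂
  let s : Option A → G := fun o => o.elim g ι
  have hsr : H₁.map ι ⊔ (H₂.map ι).map (MulAut.conj g).toMonoidHom ≤ (FreeGroup.lift s).range := by
    have hι' : ∀ x, ι x ∈ (FreeGroup.lift s).range := fun x =>
      ⟨FreeGroup.of (some x), by simp [s]⟩
    have hg' : g ∈ (FreeGroup.lift s).range := ⟨FreeGroup.of none, by simp [s]⟩
    refine sup_le ?_ ?_
    · rintro _ ⟨x, -, rfl⟩; exact hι' x
    · rintro _ ⟨_, ⟨x, -, rfl⟩, rfl⟩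
      exact Subgroup.mul_mem _ (Subgroup.mul_mem _ hg' (hι' x)) (Subgroup.inv_mem _ hg')
  obtain ⟨θ, hθ⟩ := hVC.exists_hom s hsr hNC Φ.rangeRestrict Φ.rangeRestrict_surjective
  let X : Equiv.Perm Ω := (θ (FreeGroup.of (some f)) : Φ.range)
  let Y : Equiv.Perm Ω := (θ (FreeGroup.of none) : Φ.range)
  have hU : X ^ k₁ = φ₁ a := by
    have e : FreeGroup.lift s (FreeGroup.of (some f) ^ k₁) = ι a := by simp [s, a]
    have h := congrArg Subtype.val (hθ (FreeGroup.of (some f) ^ k₁) (by rw [e]; exact hT₁ a))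
    simp only [e, MonoidHom.coe_rangeRestrict, hΦ₁ a] at h
    rw [← h, map_pow]; rfl
  have hV : Y * X ^ k₂ * Y⁻¹ = φ₂ b := by
    have e : FreeGroup.lift s (FreeGroup.of none * FreeGroup.of (some f) ^ k₂ *
      (FreeGroup.of none)⁻¹) = g * ι b * g⁻¹ := by simp [s, b]
    have h := congrArg Subtype.val (hθ (FreeGroup.of none * FreeGroup.of (some f) ^ k₂ *
      (FreeGroup.of none)⁻¹) (by rw [e]; exact hT₂ b))
    simp only [e, MonoidHom.coe_rangeRestrict, hΦ₂ b] at h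
    rw [← h, map_mul, map_mul, map_inv, map_pow]; rfl
  -- fixed points of `X ^ k₂` and of `φ₂ b` are equinumerous
  have hZ : Nat.card {ω // (X ^ k₂) ω = ω} = Nat.card {ω // φ₂ b ω = ω} := by
    refine Nat.card_congr (Equiv.subtypeEquiv Y fun ω => ?_)
    rw [← hV]
    simp
  have hUfix := hφ₁ a ha1
  rcases hor with rfl | hps
  · rw [hU] at hZ
    have : Nat.card {ω // φ₁ a ω = ω} = 1 := by
      rw [Nat.card_eq_one_iff_unique]
      refine ⟨⟨fun x y => Subtype.ext ?_⟩, ⟨⟨ω₀, (hUfix ω₀).2 rfl⟩⟩⟩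
      rw [(hUfix _).1 x.2, (hUfix _).1 y.2]
    omega
  · have hXω : X ω₀ = ω₀ := by
      rw [← hUfix, ← hU, ← Equiv.Perm.mul_apply, ← pow_succ, pow_succ', Equiv.Perm.mul_apply, hU,
        (hUfix ω₀).2 rfl]
    have hXk : (X ^ k₂) ω₀ = ω₀ := Equiv.Perm.pow_apply_eq_self_of_apply_eq_self hXω k₂
    have hmod := card_fixed_modEq_one p hp (φ₁ a) (X ^ k₂)
      (by rw [← map_pow, ← ha, pow_orderOf_eq_one, map_one])
      (by rw [← hU]; exact (Commute.refl X).pow_pow _ _) ω₀ hUfix hXk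
    rw [hZ] at hmod
    have h1 : Nat.card Ω ≡ 1 [MOD p] := by
      rw [hcard]
      have : t * (Nat.card (H₂ ⧸ K) - 1) * Nat.card H₁ ≡ 0 [MOD p] :=
        (Nat.modEq_zero_iff_dvd).2 (Dvd.dvd.mul_left hpm _)
      simpa using this.add_left 1
    rw [← hfix] at h1
    have h2 : Nat.card {ω // φ₂ b ω = ω} + t * Nat.card (H₂ ⧸ K) ≡
        Nat.card {ω // φ₂ b ω = ω} + 0 [MOD p] := h1.trans hmod.symm
    have h3 := (Nat.modEq_zero_iff_dvd).1 (Nat.ModEq.add_left_cancel' _ h2)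
    rcases (hp.dvd_mul).1 h3 with h | h
    · exact hpt h
    · exact hps h

lemma not_verballyClosed_two {A : Type*} {G : Type*} [Group A] [Finite A] [Group G] (ι : A →* G)
    (hι : Function.Injective ι) (H₁ H₂ : Subgroup A) (g : G)
    (hfp : Function.Injective (Coprod.lift
      (H₁.map ι).subtype (((H₂.map ι).map (MulAut.conj g).toMonoidHom).subtype)))
    (a : A) (ha₁ : a ∈ H₁) (ha₂ : a ∈ H₂) (ha : a ≠ 1) (hc : Nat.card H₁ = 2) :
    ¬ VerballyClosed (H₁.map ι ⊔ (H₂.map ι).map (MulAut.conj g).toMonoidHom) := by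
  intro hVC
  have hcomm : ∀ x y : H₁, x * y = y * x := by
    have : Fact (Nat.Prime 2) := ⟨Nat.prime_two⟩
    have : IsCyclic H₁ := isCyclic_of_prime_card hc
    exact fun x y => Std.Commutative.comm (op := (· * · : H₁ → H₁ → H₁)) x y
  obtain ⟨Φ, hΦ₁, hΦ₂⟩ := exists_hom_of_free ι hι H₁ H₂ g hfp (MonoidHom.id H₁) 1
  have h1 : ι a ∈ H₁.map ι ⊔ (H₂.map ι).map (MulAut.conj g).toMonoidHom :=
    Subgroup.mem_sup_left (Subgroup.mem_map_of_mem ι ha₁)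
  have h2 : g * ι (a⁻¹) * g⁻¹ ∈ H₁.map ι ⊔ (H₂.map ι).map (MulAut.conj g).toMonoidHom :=
    Subgroup.mem_sup_right (Subgroup.mem_map_of_mem (MulAut.conj g).toMonoidHom
      (Subgroup.mem_map_of_mem ι (H₂.inv_mem ha₂)))
  let w : FreeGroup Bool := FreeGroup.of true * (FreeGroup.of false * (FreeGroup.of true)⁻¹ *
    (FreeGroup.of false)⁻¹)
  let s : Bool → G := fun o => if o then ι a else g
  have e : FreeGroup.lift s w = ι a * (g * ι (a⁻¹) * g⁻¹) := by simp [w, s]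
  obtain ⟨x, hx⟩ := hVC.fintype w s (by rw [e]; exact Subgroup.mul_mem _ h1 h2)
  rw [e] at hx
  have hx' : FreeGroup.lift x w = ⟨ι a, h1⟩ * ⟨g * ι (a⁻¹) * g⁻¹, h2⟩ := Subtype.ext hx
  have h3 := congrArg Φ hx'
  have r1 := hΦ₁ ⟨a, ha₁⟩ h1
  have r2 := hΦ₂ ⟨a⁻¹, H₂.inv_mem ha₂⟩ h2
  rw [map_mul Φ ⟨ι a, h1⟩, r1, r2] at h3
  simp only [w, map_mul, map_inv, FreeGroup.lift_apply_of, MonoidHom.id_apply,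
    MonoidHom.one_apply, mul_one] at h3
  rw [hcomm (Φ (x false))] at h3
  apply ha
  have h4 : (1 : H₁) = ⟨a, ha₁⟩ := by rw [← h3]; group
  exact (congrArg Subtype.val h4).symm

lemma exists_prime_order_pow {A : Type*} [Group A] [Finite A] (a : A) (ha : a ≠ 1) :
    ∃ p k, Nat.Prime p ∧ orderOf (a ^ k) = p := by
  have h1 : orderOf a ≠ 1 := fun h => ha (orderOf_eq_one_iff.1 h)
  refine ⟨(orderOf a).minFac, orderOf a / (orderOf a).minFac, Nat.minFac_prime h1, ?_⟩
  exact orderOf_pow_orderOf_div (orderOf_pos a).ne' (Nat.minFac_dvd _)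

lemma mem_of_order_eq {A : Type*} [Group A] [Finite A] (f : A) (k₁ k₂ p : ℕ)
    (h₁ : orderOf (f ^ k₁) = p) (h₂ : orderOf (f ^ k₂) = p) (hp : p.Prime) :
    f ^ k₁ ∈ Subgroup.zpowers (f ^ k₂) := by
  set N := orderOf f with hN
  have hNpos : 0 < N := orderOf_pos f
  rw [orderOf_pow, ← hN] at h₁ h₂
  have e : Nat.gcd N k₁ = Nat.gcd N k₂ := by
    have a1 := Nat.div_mul_cancel (Nat.gcd_dvd_left N k₁)
    have a2 := Nat.div_mul_cancel (Nat.gcd_dvd_left N k₂)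
    rw [h₁] at a1
    rw [h₂] at a2
    exact Nat.eq_of_mul_eq_mul_left hp.pos (a1.trans a2.symm)
  obtain ⟨c, hc⟩ : Nat.gcd N k₂ ∣ k₁ := e ▸ Nat.gcd_dvd_right N k₁
  have hg : f ^ (Nat.gcd N k₂) = (f ^ k₂) ^ (Nat.gcdB N k₂) := by
    rw [← zpow_natCast, Nat.gcd_eq_gcd_ab, zpow_add, zpow_mul, zpow_mul, zpow_natCast, hN,
      pow_orderOf_eq_one, one_zpow, one_mul, zpow_natCast]
  rw [hc, pow_mul, hg]
  exact Subgroup.pow_mem _ (Subgroup.zpow_mem _ (Subgroup.mem_zpowers _) _) _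

lemma not_verballyClosed_general {A : Type*} {G : Type*} [Group A] [Finite A] [Group G] (ι : A →* G)
    (hι : Function.Injective ι) (H₁ H₂ : Subgroup A) (g : G)
    (hfp : Function.Injective (Coprod.lift
      (H₁.map ι).subtype (((H₂.map ι).map (MulAut.conj g).toMonoidHom).subtype)))
    (f : A) (k₁ k₂ : ℕ) (hf₁ : f ^ k₁ ∈ H₁) (hf₁' : f ^ k₁ ≠ 1)
    (hf₂ : f ^ k₂ ∈ H₂) (hf₂' : f ^ k₂ ≠ 1) :
    ¬ VerballyClosed (H₁.map ι ⊔ (H₂.map ι).map (MulAut.conj g).toMonoidHom) := by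
  obtain ⟨p, j₁, hp, ho₁⟩ := exists_prime_order_pow _ hf₁'
  obtain ⟨q, j₂, hq, ho₂⟩ := exists_prime_order_pow _ hf₂'
  have hm₁ := Subgroup.pow_mem _ hf₁ j₁
  have hm₂ := Subgroup.pow_mem _ hf₂ j₂
  rw [← pow_mul] at ho₁ ho₂ hm₁ hm₂
  generalize k₁ * j₁ = l₁ at *
  generalize k₂ * j₂ = l₂ at *
  by_cases hpq : p = q
  · subst hpq
    have hm₃ : f ^ l₁ ∈ H₂ := by
      have := mem_of_order_eq f l₁ l₂ p ho₁ ho₂ hp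
      exact (Subgroup.zpowers_le.2 hm₂) this
    have hne1 : f ^ l₁ ≠ 1 := by
      intro h; rw [h, orderOf_one] at ho₁; exact hp.one_lt.ne ho₁
    by_cases h2 : Nat.card H₁ = 2
    · exact not_verballyClosed_two ι hι H₁ H₂ g hfp _ hm₁ hm₃ hne1 h2
    · refine not_verballyClosed_core ι hι H₁ H₂ g hfp f l₁ l₁ p hp hm₁ ho₁ hm₃ ⊥ ?_ (Or.inl rfl)
        (fun h => h2 h.1)
      intro x
      induction x using QuotientGroup.induction_on with
      | H x =>
        intro h
        have h' : (((⟨f ^ l₁, hm₃⟩ : H₂) * x : H₂) : H₂ ⧸ (⊥ : Subgroup H₂)) = x := h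
        rw [QuotientGroup.eq, Subgroup.mem_bot] at h'
        have h3 : (⟨f ^ l₁, hm₃⟩ : H₂) = 1 := by
          have := inv_mul_eq_one.1 h'
          simpa using this
        exact hne1 (congrArg Subtype.val h3)
  · have : Fact p.Prime := ⟨hp⟩
    obtain ⟨P⟩ : Nonempty (Sylow p H₂) := inferInstance
    have hps : ¬ p ∣ Nat.card (H₂ ⧸ (P : Subgroup H₂)) := P.not_dvd_index
    refine not_verballyClosed_core ι hι H₁ H₂ g hfp f l₁ l₂ p hp hm₁ ho₁ hm₂ P ?_ (Or.inr hps) ?_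
    · intro x
      induction x using QuotientGroup.induction_on with
      | H x =>
        intro h
        have h' : (((⟨f ^ l₂, hm₂⟩ : H₂) * x : H₂) : H₂ ⧸ (P : Subgroup H₂)) = x := h
        have h'' := QuotientGroup.eq.1 h'.symm
        obtain ⟨n, hn⟩ := (IsPGroup.iff_orderOf.1 P.isPGroup') ⟨_, h''⟩
        rw [← Subgroup.orderOf_coe] at hn
        have hoq : orderOf (x⁻¹ * ((⟨f ^ l₂, hm₂⟩ : H₂) * x)) = q := by
          rw [← ho₂, ← mul_assoc]
          have : x⁻¹ * (⟨f ^ l₂, hm₂⟩ : H₂) * x = MulAut.conj x⁻¹ ⟨f ^ l₂, hm₂⟩ := by simp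
          rw [this, MulEquiv.orderOf_eq]
          exact (Subgroup.orderOf_coe _).symm
        simp only at hn
        rw [hoq] at hn
        have : q ∣ p := hq.dvd_of_dvd_pow (dvd_of_eq hn)
        exact hpq ((Nat.prime_dvd_prime_iff_eq hq hp).1 this).symm
    · rintro ⟨hc1, hc2⟩
      have h1 : p ∣ 2 := by
        rw [← hc1, ← ho₁, ← Subgroup.orderOf_mk _ hm₁]
        exact orderOf_dvd_natCard _
      rw [hc2] at hps
      exact hps h1

/-- Let `G = G₁ * ⋯ * Gₙ` be a free product of nontrivial finite groups, `H₁, H₂`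
subgroups of one free factor `Gᵢ`, and `f ∈ Gᵢ`, `k₁, k₂ ∈ ℕ` with `f^{k₁} ∈ H₁ \ {1}`
and `f^{k₂} ∈ H₂ \ {1}`.  Then for any `g ∈ G` the subgroup `H₁ * (gH₂g⁻¹)`
(assumed to be the free product of its factors) is not verbally closed in `G`. -/
theorem coprod_subgroup_not_verballyClosed {ι : Type*} [Fintype ι]
    (G : ι → Type*) [∀ i, Group (G i)] [∀ i, Finite (G i)] [∀ i, Nontrivial (G i)]
    (i : ι) (H₁ H₂ : Subgroup (G i)) (f : G i) (k₁ k₂ : ℕ)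
    (hf₁ : f ^ k₁ ∈ H₁) (hf₁' : f ^ k₁ ≠ 1)
    (hf₂ : f ^ k₂ ∈ H₂) (hf₂' : f ^ k₂ ≠ 1)
    (g : CoprodI G)
    (hfp : Function.Injective (Coprod.lift
      (H₁.map (CoprodI.of (M := G))).subtype
      (((H₂.map (CoprodI.of (M := G))).map (MulAut.conj g).toMonoidHom).subtype))) :
    ¬ VerballyClosed
      (H₁.map (CoprodI.of (M := G)) ⊔
        (H₂.map (CoprodI.of (M := G))).map (MulAut.conj g).toMonoidHom) := by
  exact not_verballyClosed_general _ (CoprodI.of_injective i) H₁ H₂ g hfp f k₁ k₂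
    hf₁ hf₁' hf₂ hf₂'
end

section
/- Every verbally closed subgroup of a free product G = G₁ * ⋯ * Gₙ of finitely many nontrivial finite groups is finitely generated. -/
namespace VC

section embed
variable {ι : Type*} (G : ι → Type*) [∀ i, Group (G i)]

/-- The translation action of the direct product on a free group. -/
def act : (∀ i, G i) →* MulAut (FreeGroup (ι × (∀ i, G i))) where
  toFun p := FreeGroup.freeGroupCongr (Equiv.prodCongr (Equiv.refl ι) (Equiv.mulLeft p))
  map_one' := by
    ext x
    induction x using FreeGroup.induction_on <;> simp_all
  map_mul' p q := by
    ext x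
    induction x using FreeGroup.induction_on <;> simp_all [mul_assoc, Prod.map]

theorem act_of (p q : ∀ i, G i) (i : ι) :
    act G p (FreeGroup.of (i, q)) = FreeGroup.of (i, p * q) := by
  simp [act]

variable [DecidableEq ι]

/-- Embedding of the free product into a virtually free group. -/
def emb : Monoid.CoprodI G →*
    SemidirectProduct (FreeGroup (ι × (∀ i, G i))) (∀ i, G i) (act G) :=
  Monoid.CoprodI.lift fun i =>
    (MulAut.conj (SemidirectProduct.inl (FreeGroup.of (i, 1)))).toMonoidHom.comp
      (SemidirectProduct.inr.comp (MonoidHom.mulSingle G i))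

theorem emb_of (i : ι) (g : G i) : emb G (Monoid.CoprodI.of g) =
    ⟨FreeGroup.of (i, 1) * (FreeGroup.of (i, Pi.mulSingle i g))⁻¹, Pi.mulSingle i g⟩ := by
  simp only [emb, Monoid.CoprodI.lift_of]
  ext1
  · simp [act_of]
  · simp

/-- The word of letters attached to a word in the free product. -/
def letters : List (Σ i, G i) → (∀ i, G i) → List ((ι × (∀ i, G i)) × Bool)
  | [], _ => []
  | x :: l, p => ((x.1, p), true) :: ((x.1, p * Pi.mulSingle x.1 x.2), false) ::
      letters l (p * Pi.mulSingle x.1 x.2)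

theorem act_emb (l : List (Σ i, G i)) (p : ∀ i, G i) :
    act G p (emb G (l.map fun x => Monoid.CoprodI.of x.2).prod).left
      = FreeGroup.mk (letters G l p) := by
  induction l generalizing p with
  | nil => simp [letters]; rfl
  | cons x l ih =>
    have h := ih (p * Pi.mulSingle x.1 x.2)
    rw [map_mul, MulAut.mul_apply] at h
    simp only [List.map_cons, List.prod_cons, map_mul, SemidirectProduct.mul_left, emb_of, h,
      letters, act_of, map_inv]
    simp [FreeGroup.of, FreeGroup.invRev]

theorem letters_reduced (l : List (Σ i, G i)) (p : ∀ i, G i) (h1 : ∀ x ∈ l, x.2 ≠ 1)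
    (h2 : l.IsChain fun a b => a.1 ≠ b.1) : FreeGroup.IsReduced (letters G l p) := by
  induction l generalizing p with
  | nil => simp [letters]
  | cons x l ih =>
    have ih' := ih (p * Pi.mulSingle x.1 x.2) (fun y hy => h1 y (by simp [hy])) h2.tail
    have hx : x.2 ≠ 1 := h1 x (by simp)
    simp only [letters, FreeGroup.isReduced_cons_cons]
    refine ⟨by simp [hx], ?_⟩
    cases l with
    | nil => simp [letters]
    | cons y l =>
      simp only [letters] at ih' ⊢
      rw [FreeGroup.isReduced_cons_cons]
      refine ⟨?_, ih'⟩
      rw [List.isChain_cons_cons] at h2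
      simp [h2.1]

theorem emb_injective : Function.Injective (emb G) := by
  classical
  rw [injective_iff_map_eq_one]
  intro x hx
  obtain ⟨w, rfl⟩ : ∃ w : Monoid.CoprodI.Word G, w.prod = x :=
    ⟨_, (Monoid.CoprodI.Word.equiv (M := G)).symm_apply_apply x⟩
  have h := act_emb G w.toList 1
  have hw : (w.toList.map fun x => Monoid.CoprodI.of x.2).prod = w.prod := rfl
  rw [hw, hx] at h
  have hr := letters_reduced G w.toList 1 (fun y hy => w.ne_one y hy) w.chain_ne
  have h3 : letters G w.toList 1 = [] := by
    rw [← hr.reduce_eq, ← FreeGroup.toWord_mk, ← h]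
    simp
  have h4 : w.toList = [] := by
    cases hl : w.toList with
    | nil => rfl
    | cons a l => rw [hl] at h3; simp [letters] at h3
  rw [← hw, h4]; simp

/-- any subgroup of the free product meets the kernel in a free group -/
theorem exists_free [Finite ι] [∀ i, Finite (G i)] (H : Subgroup (Monoid.CoprodI G)) :
    ∃ N : Subgroup H, N.FiniteIndex ∧ IsFreeGroup N := by
  let r : H →* (∀ i, G i) := (SemidirectProduct.rightHom.comp (emb G)).comp H.subtype
  refine ⟨r.ker, inferInstance, ?_⟩
  let f : r.ker →* FreeGroup (ι × (∀ i, G i)) :=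
    { toFun := fun x => (emb G x).left
      map_one' := by simp
      map_mul' := fun x y => by
        have hx : (emb G x).right = 1 := x.2
        simp [hx] }
  have hf : Function.Injective f := by
    rw [injective_iff_map_eq_one]
    intro x hx
    have hx2 : (emb G x).right = 1 := x.2
    have hx1 : (emb G x).left = 1 := hx
    have : emb G x = emb G 1 := by
      rw [map_one]; ext1 <;> simp [hx1, hx2]
    exact Subtype.ext (Subtype.ext (emb_injective G this))
  exact IsFreeGroup.ofMulEquiv (MonoidHom.ofInjective hf).symm

end embed
end VC

namespace VC

theorem finite_hom {G : Type*} [Group G] [hG : Group.FG G] (H : Subgroup G)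
    (hvc : VerballyClosed H) (Q : Type*) [Group Q] [Finite Q] : Finite (H →* Q) := by
  obtain ⟨S, hS⟩ := Group.fg_iff'.1 hG
  obtain ⟨S, -, hS⟩ := hS
  let e := S.equivFin
  let n := S.card
  let g : Fin n → G := fun i => (e.symm i : G)
  let ψ : FreeGroup (Fin n) →* G := FreeGroup.lift g
  have hψ : Function.Surjective ψ := by
    rw [← MonoidHom.range_eq_top, FreeGroup.range_lift_eq_closure, ← hS]
    congr 1
    ext x
    constructor
    · rintro ⟨i, rfl⟩
      exact (e.symm i).2
    · intro hx
      exact ⟨e ⟨x, hx⟩, by simp [g]⟩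
  let ev : FreeGroup (Fin n) →* ((Fin n → Q) → Q) :=
    MonoidHom.pi fun q => FreeGroup.lift q
  let R : Subgroup (FreeGroup (Fin n)) := ev.ker
  have hR : R.FiniteIndex := inferInstance
  have hRG : (R.map ψ).FiniteIndex := by
    refine ⟨fun h => hR.index_ne_zero ?_⟩
    have := R.index_map_dvd hψ
    rw [h] at this
    simpa using this
  let L : Subgroup H := (R.map ψ).subgroupOf H
  have hL : L.FiniteIndex := inferInstance
  have key : ∀ (α : H →* Q) (h : H), h ∈ L → α h = 1 := by
    intro α h hh
    obtain ⟨w, hw, hwh⟩ := hh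
    obtain ⟨x, hx, hxw⟩ := hvc n w h h.2 ⟨g, hwh⟩
    let y : Fin n → H := fun i => ⟨x i, hx i⟩
    have h1 : H.subtype (FreeGroup.lift y w) = h := by
      rw [← hxw, ← MonoidHom.comp_apply]
      congr 1
      ext i
      simp [y]
    have h2 : FreeGroup.lift y w = h := Subtype.ext h1
    have h3 : FreeGroup.lift (fun i => α (y i)) w = 1 := congrFun hw (fun i => α (y i))
    rw [← h2, ← h3, ← MonoidHom.comp_apply]
    congr 1
    ext i
    simp
  have : Finite (H ⧸ L) := inferInstance
  refine Finite.of_injective (fun (α : H →* Q) (c : H ⧸ L) => α c.out) ?_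
  intro α β hab
  ext h
  have hc := congrFun hab (QuotientGroup.mk h)
  obtain ⟨l, hl⟩ := QuotientGroup.mk_out_eq_mul L h
  simp only [hl, map_mul, key _ _ l.2, mul_one] at hc
  exact hc

theorem finite_index {H : Type*} [Group H] (m : ℕ) (hm : m ≠ 0)
    (hf : Finite (H →* Equiv.Perm (Fin m))) : {L : Subgroup H | L.index = m}.Finite := by
  have he : ∀ L : {L : Subgroup H | L.index = m}, Nonempty ((H ⧸ L.1) ≃ Fin m) := by
    intro L
    have : L.1.FiniteIndex := ⟨by rw [L.2]; exact hm⟩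
    exact ⟨Finite.equivFinOfCardEq L.2⟩
  let e := fun L => (he L).some
  let F : {L : Subgroup H | L.index = m} → (H →* Equiv.Perm (Fin m)) × Fin m := fun L =>
    ((e L).permCongrHom.toMonoidHom.comp (MulAction.toPermHom H (H ⧸ L.1)),
      e L (QuotientGroup.mk 1))
  have hmem : ∀ L h, h ∈ L.1 ↔ (F L).1 h (F L).2 = (F L).2 := by
    intro L h
    simp only [F, MulEquiv.toMonoidHom_eq_coe, MonoidHom.coe_comp, MonoidHom.coe_coe,
      Function.comp_apply, Equiv.permCongrHom_coe, Equiv.permCongr_apply, Equiv.symm_apply_apply,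
      MulAction.toPermHom_apply, MulAction.toPerm_apply, EmbeddingLike.apply_eq_iff_eq,
      MulAction.Quotient.smul_mk]
    rw [eq_comm, QuotientGroup.eq]
    simp
  have hF : Function.Injective F := by
    intro L L' h
    apply Subtype.ext
    ext x
    rw [hmem, hmem, h]
  exact Finite.of_injective F hF

theorem finite_hom_C2 {H : Type*} [Group H] 
    (hf : ∀ m, Finite (H →* Equiv.Perm (Fin m))) (N : Subgroup H) [hN : N.FiniteIndex] :
    Finite (N →* Multiplicative (ZMod 2)) := by
  have h1 := finite_index N.index hN.index_ne_zero (hf _)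
  have h2 := finite_index (2 * N.index) (by simpa using hN.index_ne_zero) (hf _)
  have := (h1.union h2).to_subtype
  have hidx : ∀ φ : N →* Multiplicative (ZMod 2), φ.ker.map N.subtype ∈
      {L : Subgroup H | L.index = N.index} ∪ {L : Subgroup H | L.index = 2 * N.index} := by
    intro φ
    have hd : φ.ker.index ∣ 2 := by
      rw [Subgroup.index_ker]
      simpa using Subgroup.card_subgroup_dvd_card φ.range
    rw [Nat.dvd_prime Nat.prime_two] at hd
    have hi : (φ.ker.map N.subtype).index = φ.ker.index * N.index := by
      rw [Subgroup.index_map]; simp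
    rcases hd with h | h
    · left; simp [hi, h]
    · right; simp [hi, h]
  refine Finite.of_injective (fun φ => (⟨_, hidx φ⟩ : ↥(_ ∪ _ : Set (Subgroup H)))) ?_
  intro φ ψ h
  have hk : φ.ker = ψ.ker := Subgroup.map_injective N.subtype_injective (congrArg Subtype.val h)
  ext x
  have hx : φ x = 1 ↔ ψ x = 1 := by
    rw [← MonoidHom.mem_ker, hk, MonoidHom.mem_ker]
  generalize φ x = a at *
  generalize ψ x = b at *
  revert a b
  decide

theorem fg_of_finiteIndex {H : Type*} [Group H] (N : Subgroup H) [N.FiniteIndex]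
    [hN : Group.FG N] : Group.FG H := by
  rw [Group.fg_iff_subgroup_fg] at hN
  obtain ⟨S, hS, hfin⟩ := (Subgroup.fg_iff N).1 hN
  rw [Group.fg_iff]
  refine ⟨S ∪ Set.range (Quotient.out : H ⧸ N → H), ?_, hfin.union ?fin⟩
  case fin =>
    have : Finite (H ⧸ N) := inferInstance
    exact Set.finite_range (fun c : H ⧸ N => c.out)
  rw [eq_top_iff]
  intro x _
  obtain ⟨l, hl⟩ := QuotientGroup.mk_out_eq_mul N x
  have hx : x = (QuotientGroup.mk x : H ⧸ N).out * (l : H)⁻¹ := by rw [hl]; simp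
  rw [hx]
  refine mul_mem (Subgroup.subset_closure (Or.inr ⟨_, rfl⟩)) (inv_mem ?_)
  have hl2 : (l : H) ∈ Subgroup.closure S := by rw [hS]; exact l.2
  exact Subgroup.closure_mono Set.subset_union_left hl2

theorem fg_of_free {H : Type*} [Group H]
    (hf : ∀ m, Finite (H →* Equiv.Perm (Fin m))) (N : Subgroup H) [hN : N.FiniteIndex]
    [IsFreeGroup N] : Group.FG H := by
  have h := finite_hom_C2 hf N
  have h2 : Finite (IsFreeGroup.Generators N → Multiplicative (ZMod 2)) :=
    Finite.of_equiv _ (IsFreeGroup.lift (G := N)).symm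
  have h3 : Finite (IsFreeGroup.Generators N) := by
    classical
    refine Finite.of_injective (fun i => (Pi.mulSingle i (Multiplicative.ofAdd 1) :
      IsFreeGroup.Generators N → Multiplicative (ZMod 2))) ?_
    intro i j hij
    by_contra hne
    have := congrFun hij i
    simp [hne] at this
  have : Group.FG N := Group.fg_of_surjective (f := (IsFreeGroup.mulEquiv N).toMonoidHom) (IsFreeGroup.mulEquiv N).surjective
  exact fg_of_finiteIndex N
theorem fgC {ι : Type*} [Finite ι]
    (G : ι → Type*) [∀ i, Group (G i)] [∀ i, Finite (G i)] : Group.FG (Monoid.CoprodI G) := by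
  rw [Group.fg_iff]
  refine ⟨⋃ i, Set.range (Monoid.CoprodI.of : G i →* _), ?_, Set.finite_iUnion fun i => Set.finite_range _⟩
  rw [eq_top_iff]
  intro x _
  induction x using Monoid.CoprodI.induction_on with
  | one => exact one_mem _
  | of i m => exact Subgroup.subset_closure (Set.mem_iUnion.2 ⟨i, m, rfl⟩)
  | mul x y hx hy => exact mul_mem (hx trivial) (hy trivial)
end VC

/-- Every verbally closed subgroup of a free product of finitely many nontrivial
finite groups is finitely generated. -/
theorem verballyClosed_fg {ι : Type*} [Fintype ι]
    (G : ι → Type*) [∀ i, Group (G i)] [∀ i, Finite (G i)] [∀ i, Nontrivial (G i)]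
    (H : Subgroup (Monoid.CoprodI G)) (hvc : VerballyClosed H) :
    H.FG := by
  classical
  obtain ⟨N, hN, hfree⟩ := VC.exists_free G H
  have hG := VC.fgC G
  rw [← Group.fg_iff_subgroup_fg]
  exact VC.fg_of_free (fun m => VC.finite_hom H hvc _) N
end
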